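/- Let p > 1, p ≠ Q. Let Ω₁ ⋐ Ω₂ ⊂ ℍⁿ be bounded open sets with C¹ boundaries, both containing the origin and both strictly starshaped with respect to the origin. Assume Ω₁ satisfies a uniform exterior gauge ball property and Ω₂ satisfies a uniform interior gauge ball property. Let u : closure(Ω₂)∖Ω₁ → ℝ be continuous, C¹ and weakly horizontally p-harmonic in Ω₂∖closure(Ω₁), with u = 1 on ∂Ω₁ and u = 0 on ∂Ω₂. Then for every t ∈ [0,1] the set {u ≥ t} ∪ closure(Ω₁) is a bounded set with C¹ boundary that is strictly starshaped with respect to the origin, and the Euclidean gradient ∇u does not vanish at any point of Ω₂∖closure(Ω₁). -/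

import Mathlib

open MeasureTheory Real Set

noncomputable section

/-- The underlying space of the Heisenberg group `ℍⁿ`, i.e. `ℝ^(2n+1)`,
with coordinates `(x₁, …, xₙ, y₁, …, yₙ, t)`. -/
abbrev Heis (n : ℕ) := Fin (2 * n + 1) → ℝ

namespace Heis

variable {n : ℕ}

/-- The index of the coordinate `xᵢ`. -/
def xIdx (n : ℕ) (i : Fin n) : Fin (2 * n + 1) := ⟨(i : ℕ), by have := i.isLt; omega⟩

/-- The index of the coordinate `yᵢ`. -/
def yIdx (n : ℕ) (i : Fin n) : Fin (2 * n + 1) := ⟨n + (i : ℕ), by have := i.isLt; omega⟩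

/-- The index of the coordinate `t`. -/
def tIdx (n : ℕ) : Fin (2 * n + 1) := ⟨2 * n, by omega⟩

/-- The Heisenberg group product. -/
def mul (z w : Heis n) : Heis n := fun k =>
  if (k : ℕ) = 2 * n then
    z k + w k + 2 * ∑ i : Fin n,
      (w (xIdx n i) * z (yIdx n i) - z (xIdx n i) * w (yIdx n i))
  else z k + w k

/-- The Heisenberg group inverse. -/
def inv (z : Heis n) : Heis n := fun k => - z k

/-- The Koranyi gauge `ρ`. -/
def rho (z : Heis n) : ℝ :=
  ((∑ i : Fin n, (z (xIdx n i) ^ 2 + z (yIdx n i) ^ 2)) ^ 2 + z (tIdx n) ^ 2) ^ ((1 : ℝ) / 4)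

/-- The gauge ball `B_ρ(z, R) = {w | ρ(w⁻¹ ⬝ z) < R}`. -/
def gaugeBall (z : Heis n) (R : ℝ) : Set (Heis n) := {w | rho (mul (inv w) z) < R}

/-- The anisotropic dilations `δ_λ`. -/
def dil (lam : ℝ) (z : Heis n) : Heis n := fun k =>
  if (k : ℕ) = 2 * n then Real.exp (2 * lam) * z k else Real.exp lam * z k

/-- The dilation-generating vector field `Z(z) = (x₁, …, xₙ, y₁, …, yₙ, 2t)`. -/
def Zvf (z : Heis n) : Heis n := fun k => if (k : ℕ) = 2 * n then 2 * z k else z k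

/-- The Euclidean scalar product of `ℝ^(2n+1)`. -/
def einner (v w : Heis n) : ℝ := ∑ k, v k * w k

/-- The Euclidean norm of `ℝ^(2n+1)`. -/
def euclNorm (v : Heis n) : ℝ := Real.sqrt (∑ k, v k ^ 2)

/-- The Euclidean gradient of `f`, via the Fréchet derivative. -/
def grad (f : Heis n → ℝ) (z : Heis n) : Heis n := fun k => fderiv ℝ f z (Pi.single k 1)

/-- The horizontal derivative `Xᵢ f = ∂f/∂xᵢ + 2 yᵢ ∂f/∂t`. -/
def Xd (i : Fin n) (f : Heis n → ℝ) (z : Heis n) : ℝ :=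
  grad f z (xIdx n i) + 2 * z (yIdx n i) * grad f z (tIdx n)

/-- The horizontal derivative `Yⱼ f = ∂f/∂yⱼ − 2 xⱼ ∂f/∂t`. -/
def Yd (i : Fin n) (f : Heis n → ℝ) (z : Heis n) : ℝ :=
  grad f z (yIdx n i) - 2 * z (xIdx n i) * grad f z (tIdx n)

/-- The horizontal gradient `∇_ℍ f = (X₁ f, …, Xₙ f, Y₁ f, …, Yₙ f)`. -/
def hGrad (f : Heis n → ℝ) (z : Heis n) : (Fin n → ℝ) × (Fin n → ℝ) :=
  (fun i => Xd i f z, fun i => Yd i f z)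

/-- The norm `|∇_ℍ f|` of the horizontal gradient. -/
def hNorm (f : Heis n → ℝ) (z : Heis n) : ℝ :=
  Real.sqrt (∑ i : Fin n, ((Xd i f z) ^ 2 + (Yd i f z) ^ 2))

/-- `f` is weakly horizontally `p`-harmonic on the open set `U` :
`f` and `∇_ℍ f` are locally `p`-integrable on `U` and
`∫_U |∇_ℍ f|^(p−2) ⟨∇_ℍ f, ∇_ℍ φ⟩ = 0` for every `C¹` function `φ`
with compact support contained in `U` (note that `Real.rpow` makes the
integrand vanish at points where `∇_ℍ f = 0`). -/
def PHarmonicOn (p : ℝ) (f : Heis n → ℝ) (U : Set (Heis n)) : Prop :=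
  LocallyIntegrableOn (fun z => |f z| ^ p) U volume ∧
  LocallyIntegrableOn (fun z => hNorm f z ^ p) U volume ∧
  ∀ φ : Heis n → ℝ, ContDiff ℝ 1 φ → HasCompactSupport φ → tsupport φ ⊆ U →
    ∫ z in U, hNorm f z ^ (p - 2) *
      (∑ i : Fin n, (Xd i f z * Xd i φ z + Yd i f z * Yd i φ z)) = 0

/-- `Ω` has `C¹` boundary, with Euclidean outward unit normal `ν` on `∂Ω` :
near every boundary point, `Ω` is the sublevel set of a `C¹` defining function
with nonvanishing (Euclidean) gradient, and `ν` is the normalized gradient. -/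
def HasC1Boundary (Ω : Set (Heis n)) (ν : Heis n → Heis n) : Prop :=
  ∀ z ∈ frontier Ω, ∃ (V : Set (Heis n)) (g : Heis n → ℝ),
    IsOpen V ∧ z ∈ V ∧ ContDiff ℝ 1 g ∧
    (∀ w ∈ V, (w ∈ interior Ω ↔ g w < 0)) ∧
    (∀ w ∈ V, (w ∈ frontier Ω ↔ g w = 0)) ∧
    (∀ w ∈ V, w ∈ frontier Ω →
      grad g w ≠ 0 ∧ ν w = (euclNorm (grad g w))⁻¹ • grad g w)

/-- `Ω` (with `C¹` boundary and Euclidean outward unit normal `ν`) is strictly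
starshaped with respect to the origin : it contains the origin and `⟨ν, Z⟩ > 0`
everywhere on `∂Ω`. -/
def StrictStarshaped (Ω : Set (Heis n)) (ν : Heis n → Heis n) : Prop :=
  (0 : Heis n) ∈ Ω ∧ HasC1Boundary Ω ν ∧
    ∀ z ∈ frontier Ω, 0 < einner (ν z) (Zvf z)

/-- `Ω` satisfies the exterior gauge ball property at `z ∈ ∂Ω`, with exterior
tangent gauge ball `B_ρ(z₁, R)`. -/
def ExteriorGaugeBallAt (Ω : Set (Heis n)) (z z₁ : Heis n) (R : ℝ) : Prop :=
  z₁ ∉ closure Ω ∧ gaugeBall z₁ R ⊆ (closure Ω)ᶜ ∧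
    closure (gaugeBall z₁ R) ∩ frontier Ω = {z}

/-- `Ω` satisfies a uniform exterior gauge ball property. -/
def UniformExteriorGaugeBall (Ω : Set (Heis n)) : Prop :=
  ∃ R > 0, ∀ z ∈ frontier Ω, ∃ z₁, ExteriorGaugeBallAt Ω z z₁ R

/-- `Ω` satisfies the interior gauge ball property at `z ∈ ∂Ω`, with interior
tangent gauge ball `B_ρ(z₂, R)`. -/
def InteriorGaugeBallAt (Ω : Set (Heis n)) (z z₂ : Heis n) (R : ℝ) : Prop :=
  z₂ ∈ Ω ∧ gaugeBall z₂ R ⊆ Ω ∧ closure (gaugeBall z₂ R) ∩ frontier Ω = {z}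

/-- `Ω` satisfies a uniform interior gauge ball property. -/
def UniformInteriorGaugeBall (Ω : Set (Heis n)) : Prop :=
  ∃ R > 0, ∀ z ∈ frontier Ω, ∃ z₂, InteriorGaugeBallAt Ω z z₂ R

end Heis

namespace Heis

open Filter Topology

variable {n : ℕ}

/-! ### Horizontal gradient and weak subsolutions -/

/-- The horizontal frame `X₁, …, Xₙ, Y₁, …, Yₙ` at `z`. -/
def frame (z : Heis n) : Fin n ⊕ Fin n → Heis n
  | .inl i => Pi.single (xIdx n i) 1 + (2 * z (yIdx n i)) • Pi.single (tIdx n) 1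
  | .inr i => Pi.single (yIdx n i) 1 - (2 * z (xIdx n i)) • Pi.single (tIdx n) 1

/-- The horizontal gradient as a vector of a Euclidean space. -/
def hgrad (f : Heis n → ℝ) (z : Heis n) : EuclideanSpace ℝ (Fin n ⊕ Fin n) :=
  WithLp.toLp 2 fun k => fderiv ℝ f z (frame z k)

/-- The integrand `|∇f|^(p-2) ⟨∇f, ∇φ⟩` of the weak `p`-Laplacian. -/
def energy (p : ℝ) (f φ : Heis n → ℝ) (z : Heis n) : ℝ :=
  ‖hgrad f z‖ ^ (p - 2) * inner ℝ (hgrad f z) (hgrad φ z)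

/-- Weak subsolutions of the horizontal `p`-Laplace equation. -/
def WeakSub (p : ℝ) (f : Heis n → ℝ) (U : Set (Heis n)) : Prop :=
  ∀ φ : Heis n → ℝ, ContDiff ℝ 1 φ → HasCompactSupport φ → tsupport φ ⊆ U → (∀ z, 0 ≤ φ z) →
    ∫ z, energy p f φ z ≤ 0

lemma hgrad_apply (f : Heis n → ℝ) (z : Heis n) (k : Fin n ⊕ Fin n) :
    hgrad f z k = fderiv ℝ f z (frame z k) := rfl

lemma Xd_eq (i : Fin n) (f : Heis n → ℝ) (z : Heis n) : Xd i f z = hgrad f z (.inl i) := by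
  simp [hgrad_apply, frame, Xd, grad, mul_assoc]

lemma Yd_eq (i : Fin n) (f : Heis n → ℝ) (z : Heis n) : Yd i f z = hgrad f z (.inr i) := by
  simp [hgrad_apply, frame, Yd, grad, mul_assoc]

lemma hNorm_eq (f : Heis n → ℝ) (z : Heis n) : hNorm f z = ‖hgrad f z‖ := by
  simp [hNorm, EuclideanSpace.norm_eq, Xd_eq, Yd_eq, Finset.sum_add_distrib]

lemma inner_hgrad (f g : Heis n → ℝ) (z : Heis n) :
    inner ℝ (hgrad f z) (hgrad g z) =
      ∑ i : Fin n, (Xd i f z * Xd i g z + Yd i f z * Yd i g z) := by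
  simp [PiLp.inner_apply, Xd_eq, Yd_eq, Finset.sum_add_distrib, mul_comm]

lemma hgrad_congr {f g : Heis n → ℝ} {z : Heis n} (h : f =ᶠ[𝓝 z] g) :
    hgrad f z = hgrad g z := by
  ext k
  simp [hgrad_apply, h.fderiv_eq]

lemma hgrad_const (c : ℝ) (z : Heis n) : hgrad (fun _ : Heis n => c) z = 0 := by
  ext k
  simp [hgrad_apply]

lemma hgrad_neg (f : Heis n → ℝ) (z : Heis n) : hgrad (fun w => -f w) z = -hgrad f z := by
  ext k
  simp [hgrad_apply, fderiv_fun_neg]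

lemma hgrad_add_const (f : Heis n → ℝ) (c : ℝ) (z : Heis n) :
    hgrad (fun w => f w + c) z = hgrad f z := by
  ext k
  simp [hgrad_apply]

lemma hgrad_const_mul (f : Heis n → ℝ) (c : ℝ) (z : Heis n) :
    hgrad (fun w => c * f w) z = c • hgrad f z := by
  ext k
  have h1 : fderiv ℝ (fun w => c * f w) z = c • fderiv ℝ f z :=
    congrFun (fderiv_const_smul_field (𝕜 := ℝ) (f := f) c) z
  simp [hgrad_apply, h1]

lemma hgrad_eq_zero_of_notMem {φ : Heis n → ℝ} {z : Heis n} (hz : z ∉ tsupport φ) :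
    hgrad φ z = 0 := by
  rw [hgrad_congr (notMem_tsupport_iff_eventuallyEq.1 hz)]
  exact hgrad_const 0 z

lemma energy_eq_zero_of_notMem {p : ℝ} {f φ : Heis n → ℝ} {z : Heis n} (hz : z ∉ tsupport φ) :
    energy p f φ z = 0 := by
  simp [energy, hgrad_eq_zero_of_notMem hz]

lemma continuous_frame (k : Fin n ⊕ Fin n) : Continuous fun z : Heis n => frame z k := by
  rcases k with i | i <;> simp only [frame] <;> fun_prop

lemma continuousAt_hgrad {f : Heis n → ℝ} {z : Heis n} (hf : ContDiffAt ℝ 1 f z) :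
    ContinuousAt (hgrad f) z := by
  refine (PiLp.continuous_toLp 2 _).continuousAt.comp (continuousAt_pi.2 fun k => ?_)
  exact (hf.continuousAt_fderiv (by simp)).clm_apply (continuous_frame k).continuousAt

lemma PHarmonicOn.integral_energy {p : ℝ} {f : Heis n → ℝ} {U : Set (Heis n)}
    (h : PHarmonicOn p f U) {φ : Heis n → ℝ} (hφ : ContDiff ℝ 1 φ) (hc : HasCompactSupport φ)
    (hs : tsupport φ ⊆ U) : ∫ z, energy p f φ z = 0 := by
  rw [← h.2.2 φ hφ hc hs, ← setIntegral_eq_integral_of_forall_compl_eq_zero (s := U)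
    fun z hz => energy_eq_zero_of_notMem fun h => hz (hs h)]
  simp only [energy, hNorm_eq, inner_hgrad]

lemma PHarmonicOn.weakSub {p : ℝ} {f : Heis n → ℝ} {U : Set (Heis n)}
    (h : PHarmonicOn p f U) : WeakSub p f U := fun _ hφ hc hs _ =>
  (h.integral_energy hφ hc hs).le

lemma PHarmonicOn.weakSub_neg {p : ℝ} {f : Heis n → ℝ} {U : Set (Heis n)}
    (h : PHarmonicOn p f U) : WeakSub p (fun z => -f z) U := fun φ hφ hc hs _ => by
  have : ∀ z, energy p (fun z => -f z) φ z = -energy p f φ z := fun z => by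
    simp [energy, hgrad_neg]
  simp only [this, integral_neg, h.integral_energy hφ hc hs, neg_zero, le_refl]

lemma WeakSub.mono {p : ℝ} {f : Heis n → ℝ} {U V : Set (Heis n)} (h : WeakSub p f U)
    (hV : V ⊆ U) : WeakSub p f V := fun φ hφ hc hs h0 => h φ hφ hc (hs.trans hV) h0

lemma WeakSub.congr {p : ℝ} {f g : Heis n → ℝ} {U : Set (Heis n)} (h : WeakSub p f U)
    (hU : IsOpen U) (hfg : EqOn f g U) : WeakSub p g U := fun φ hφ hc hs h0 => by
  convert h φ hφ hc hs h0 using 2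
  ext z
  by_cases hz : z ∈ tsupport φ
  · have : g =ᶠ[𝓝 z] f := (eventuallyEq_of_mem (hU.mem_nhds (hs hz)) hfg).symm
    simp only [energy, hgrad_congr this]
  · simp only [energy_eq_zero_of_notMem hz]

lemma weakSub_const {p : ℝ} (c : ℝ) (U : Set (Heis n)) : WeakSub p (fun _ => c) U :=
  fun φ _ _ _ _ => by simp [energy, hgrad_const]

lemma WeakSub.add_const {p : ℝ} {f : Heis n → ℝ} {U : Set (Heis n)} (h : WeakSub p f U)
    (c : ℝ) : WeakSub p (fun z => f z + c) U := fun φ hφ hc hs h0 => by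
  simpa only [energy, hgrad_add_const] using h φ hφ hc hs h0

lemma WeakSub.const_mul {p : ℝ} {f : Heis n → ℝ} {U : Set (Heis n)} (h : WeakSub p f U)
    {c : ℝ} (hc0 : 0 ≤ c) : WeakSub p (fun z => c * f z) U := fun φ hφ hc hs h0 => by
  have : ∀ z, energy p (fun z => c * f z) φ z = c ^ (p - 2) * c * energy p f φ z := fun z => by
    simp only [energy, hgrad_const_mul, norm_smul, inner_smul_left, Real.norm_eq_abs,
      abs_of_nonneg hc0, Real.mul_rpow hc0 (norm_nonneg _)]
    simp
    ring
  simp only [this, integral_const_mul]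
  exact mul_nonpos_of_nonneg_of_nonpos (by positivity) (h φ hφ hc hs h0)

/-! ### The comparison principle -/

section Monotone

variable {E : Type*} [NormedAddCommGroup E] [InnerProductSpace ℝ E]

lemma rpow_sub_two_mul_self {p x : ℝ} (hp : 1 < p) (hx : 0 ≤ x) :
    x ^ (p - 2) * x = x ^ (p - 1) := by
  rcases hx.eq_or_lt with rfl | hx
  · rw [mul_zero, Real.zero_rpow (by linarith)]
  · rw [← Real.rpow_add_one hx.ne']
    ring_nf

lemma continuous_rpow_norm_smul {p : ℝ} (hp : 1 < p) :
    Continuous fun a : E => ‖a‖ ^ (p - 2) • a := by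
  refine continuous_iff_continuousAt.2 fun a => ?_
  by_cases ha : a = 0
  · subst ha
    rw [ContinuousAt, smul_zero, tendsto_zero_iff_norm_tendsto_zero]
    have h1 : ∀ a : E, ‖‖a‖ ^ (p - 2) • a‖ = ‖a‖ ^ (p - 1) := fun a => by
      rw [norm_smul, Real.norm_eq_abs, abs_of_nonneg (by positivity),
        rpow_sub_two_mul_self hp (norm_nonneg a)]
    simp only [h1]
    have h2 : Continuous fun a : E => ‖a‖ ^ (p - 1) :=
      continuous_norm.rpow_const fun _ => Or.inr (by linarith)
    simpa [Real.zero_rpow (show p - 1 ≠ 0 by linarith)] using h2.tendsto 0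
  · exact (continuous_norm.continuousAt.rpow_const (Or.inl (by simpa using ha))).smul
      continuousAt_id

lemma inner_rpow_norm_smul_sub_pos {p : ℝ} (hp : 1 < p) {a b : E} (hab : a ≠ b) :
    0 < inner ℝ (‖a‖ ^ (p - 2) • a - ‖b‖ ^ (p - 2) • b) (a - b) := by
  have expand : inner ℝ (‖a‖ ^ (p - 2) • a - ‖b‖ ^ (p - 2) • b) (a - b) =
      (‖a‖ ^ (p - 2) * ‖a‖ - ‖b‖ ^ (p - 2) * ‖b‖) * (‖a‖ - ‖b‖) +
        (‖a‖ ^ (p - 2) + ‖b‖ ^ (p - 2)) * (‖a‖ * ‖b‖ - inner ℝ a b) := by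
    simp only [inner_sub_left, inner_sub_right, real_inner_smul_left,
      real_inner_self_eq_norm_sq, real_inner_comm a b]
    ring
  have hcs := real_inner_le_norm a b
  have ha := Real.rpow_nonneg (norm_nonneg a) (p - 2)
  have hb := Real.rpow_nonneg (norm_nonneg b) (p - 2)
  by_cases hn : ‖a‖ = ‖b‖
  · have hpos : 0 < ‖b‖ := by
      rcases (norm_nonneg b).eq_or_lt with h | h
      · rw [← h] at hn
        exact absurd ((norm_eq_zero.1 hn).trans (norm_eq_zero.1 h.symm).symm) hab
      · exact h
    rw [hn, ← smul_sub, real_inner_smul_left, real_inner_self_eq_norm_sq]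
    have : 0 < ‖a - b‖ := norm_pos_iff.2 (sub_ne_zero.2 hab)
    positivity
  · rw [expand, rpow_sub_two_mul_self hp (norm_nonneg a), rpow_sub_two_mul_self hp (norm_nonneg b)]
    have h1 : 0 < (‖a‖ ^ (p - 1) - ‖b‖ ^ (p - 1)) * (‖a‖ - ‖b‖) := by
      rcases lt_or_gt_of_ne hn with h | h
      · exact mul_pos_of_neg_of_neg
          (sub_neg.2 (Real.rpow_lt_rpow (norm_nonneg a) h (by linarith))) (sub_neg.2 h)
      · exact mul_pos (sub_pos.2 (Real.rpow_lt_rpow (norm_nonneg b) h (by linarith)))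
          (sub_pos.2 h)
    have h2 := mul_nonneg (add_nonneg ha hb) (sub_nonneg.2 hcs)
    linarith

end Monotone

/-- A compactly supported function with vanishing horizontal gradient is zero. -/
lemma eq_zero_of_hgrad_eq_zero (hn : 1 ≤ n) {φ : Heis n → ℝ} (hφ : ContDiff ℝ 1 φ)
    (hc : HasCompactSupport φ) (h : ∀ z, hgrad φ z = 0) (z : Heis n) : φ z = 0 := by
  set i : Fin n := ⟨0, hn⟩
  set v := frame z (.inl i) with hv
  have hxy : xIdx n i ≠ yIdx n i := by
    intro h
    have := congrArg Fin.val h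
    simp [xIdx, yIdx, i] at this
    omega
  have hty : tIdx n ≠ yIdx n i := by
    intro h
    have := congrArg Fin.val h
    simp [tIdx, yIdx, i] at this
    omega
  have hxt : xIdx n i ≠ tIdx n := by
    intro h
    have := congrArg Fin.val h
    simp [tIdx, xIdx, i] at this
    omega
  have hfr : ∀ s : ℝ, frame (z + s • v) (.inl i) = v := fun s => by
    simp [hv, frame, Pi.single_eq_of_ne hxy.symm, Pi.single_eq_of_ne hty.symm]
  have hd : ∀ s : ℝ, HasDerivAt (fun s : ℝ => φ (z + s • v)) 0 s := fun s => by
    have h1 : HasDerivAt (fun s : ℝ => z + s • v) v s := by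
      simpa using ((hasDerivAt_id s).smul_const v).const_add z
    have h2 := ((hφ.differentiable (by simp) (z + s • v)).hasFDerivAt.comp_hasDerivAt s h1)
    have h3 : fderiv ℝ φ (z + s • v) v = 0 := by
      have := congrArg (fun a => a (.inl i)) (h (z + s • v))
      simpa [hgrad_apply, hfr] using this
    rwa [h3] at h2
  have hconst : ∀ s : ℝ, φ (z + s • v) = φ z := fun s => by
    have := is_const_of_deriv_eq_zero (fun s => (hd s).differentiableAt)
      (fun s => (hd s).deriv) s 0
    simpa using this
  obtain ⟨C, hC⟩ := hc.isCompact.isBounded.exists_norm_le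
  by_contra hne
  have hmem : ∀ s : ℝ, ‖z + s • v‖ ≤ C := fun s =>
    hC _ (subset_tsupport _ (by simpa [hconst s] using hne))
  have h1 := (norm_le_pi_norm (z + (C + 1 - z (xIdx n i)) • v) (xIdx n i)).trans
    (hmem (C + 1 - z (xIdx n i)))
  have hv1 : v (xIdx n i) = 1 := by simp [hv, frame, Pi.single_eq_of_ne hxt]
  simp only [Pi.add_apply, Pi.smul_apply, hv1, smul_eq_mul, mul_one, Real.norm_eq_abs] at h1
  have := (le_abs_self _).trans h1
  linarith

lemma contDiffAt_max_zero_sq (x : ℝ) : ContDiffAt ℝ 1 (fun x : ℝ => (max x 0) ^ 2) x ∧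
    HasDerivAt (fun x : ℝ => (max x 0) ^ 2) (2 * max x 0) x := by
  have hd : ∀ x : ℝ, HasDerivAt (fun x : ℝ => (max x 0) ^ 2) (2 * max x 0) x := fun x => by
    rcases lt_trichotomy x 0 with h | h | h
    · rw [max_eq_right h.le, mul_zero]
      refine (hasDerivAt_const x (0 : ℝ)).congr_of_eventuallyEq ?_
      filter_upwards [Iio_mem_nhds h] with y hy
      rw [max_eq_right (le_of_lt hy)]
      ring
    · subst h
      rw [hasDerivAt_iff_isLittleO]
      simp only [max_self, mul_zero, sub_zero, smul_zero, ne_eq, OfNat.ofNat_ne_zero,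
        not_false_eq_true, zero_pow]
      have h1 : (fun x : ℝ => (max x 0) ^ 2) =O[𝓝 0] fun x : ℝ => x ^ 2 := by
        refine Asymptotics.IsBigO.of_bound 1 (Eventually.of_forall fun y => ?_)
        rw [Real.norm_eq_abs, Real.norm_eq_abs, abs_of_nonneg (by positivity),
          abs_of_nonneg (by positivity), one_mul, sq_le_sq, abs_of_nonneg (le_max_right y 0)]
        exact max_le (le_abs_self y) (abs_nonneg y)
      have h2 : (fun x : ℝ => x ^ 2) =o[𝓝 0] fun x : ℝ => x := by
        simpa using Asymptotics.isLittleO_pow_pow (𝕜 := ℝ) (m := 1) (n := 2) (by norm_num)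
      exact h1.trans_isLittleO h2
    · rw [max_eq_left h.le]
      have h1 : HasDerivAt (fun x : ℝ => x ^ 2) (2 * x) x := by simpa using hasDerivAt_pow 2 x
      refine h1.congr_of_eventuallyEq ?_
      filter_upwards [Ioi_mem_nhds h] with y hy
      rw [max_eq_left (le_of_lt hy)]
  refine ⟨ContDiff.contDiffAt ?_, hd x⟩
  rw [contDiff_one_iff_deriv]
  refine ⟨fun x => (hd x).differentiableAt, ?_⟩
  have : deriv (fun x : ℝ => (max x 0) ^ 2) = fun x => 2 * max x 0 := funext fun x => (hd x).deriv
  rw [this]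
  fun_prop

/-- Weak comparison principle. -/
lemma comparison (hn : 1 ≤ n) {p : ℝ} (hp : 1 < p) {U : Set (Heis n)} (hU : IsOpen U)
    (hb : Bornology.IsBounded U) {f h : Heis n → ℝ} (hf : WeakSub p f U)
    (hh : WeakSub p (fun z => -h z) U) (hf1 : ContDiffOn ℝ 1 f U) (hh1 : ContDiffOn ℝ 1 h U)
    (hfc : ContinuousOn f (closure U)) (hhc : ContinuousOn h (closure U))
    (hle : ∀ z ∈ closure U, z ∉ U → f z ≤ h z) : ∀ z ∈ U, f z ≤ h z := by
  intro z₀ hz₀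
  by_contra! hlt
  set ε := (f z₀ - h z₀) / 2 with hε
  have hε0 : 0 < ε := by rw [hε]; linarith
  set K := closure U ∩ {z | ε ≤ f z - h z} with hK
  have hKc : IsClosed K := by
    have := (hfc.sub hhc).preimage_isClosed_of_isClosed isClosed_closure (isClosed_Ici (a := ε))
    exact this
  have hKU : K ⊆ U := fun z hz => by
    by_contra hzU
    have h1 := hle z hz.1 hzU
    have h2 : ε ≤ f z - h z := hz.2
    linarith
  have hKcomp : IsCompact K := Metric.isCompact_of_isClosed_isBounded hKc (hb.subset hKU)
  classical
  set w : Heis n → ℝ := fun z => max (f z - h z - ε) 0 with hw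
  set φ : Heis n → ℝ := fun z => if z ∈ U then (w z) ^ 2 else 0 with hφ
  have hwK : ∀ z ∈ U, z ∉ K → w z = 0 := fun z hz hzK => by
    refine max_eq_right ?_
    by_contra! hc
    exact hzK ⟨subset_closure hz, by simp only [mem_ofPred_eq]; linarith⟩
  have hφK : ∀ z, z ∉ K → φ z = 0 := fun z hzK => by
    simp only [hφ]
    split_ifs with hz
    · rw [hwK z hz hzK, zero_pow two_ne_zero]
    · rfl
  have hφnear : ∀ z, z ∉ K → φ =ᶠ[𝓝 z] fun _ => 0 := fun z hz => by
    filter_upwards [hKc.isOpen_compl.mem_nhds hz] with y hy using hφK y hy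
  have hφU : ∀ z ∈ U, φ =ᶠ[𝓝 z] fun z => (max (f z - h z - ε) 0) ^ 2 := fun z hz => by
    filter_upwards [hU.mem_nhds hz] with y hy
    simp [hφ, hw, hy]
  have hfz : ∀ z ∈ U, ContDiffAt ℝ 1 f z := fun z hz => hf1.contDiffAt (hU.mem_nhds hz)
  have hhz : ∀ z ∈ U, ContDiffAt ℝ 1 h z := fun z hz => hh1.contDiffAt (hU.mem_nhds hz)
  have hφ1 : ContDiff ℝ 1 φ := contDiff_iff_contDiffAt.2 fun z => by
    by_cases hz : z ∈ K
    · have hzU := hKU hz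
      refine ContDiffAt.congr_of_eventuallyEq ?_ (hφU z hzU)
      exact (contDiffAt_max_zero_sq (f z - h z - ε)).1.comp z
        (((hfz z hzU).sub (hhz z hzU)).sub contDiffAt_const)
    · exact contDiffAt_const.congr_of_eventuallyEq (hφnear z hz)
  have hsupp : tsupport φ ⊆ K := closure_minimal (fun z hz => by
    by_contra h; exact hz (hφK z h)) hKc
  have hcs : HasCompactSupport φ := hKcomp.of_isClosed_subset (isClosed_tsupport φ) hsupp
  have hgr : ∀ z ∈ U, hgrad φ z = (2 * w z) • (hgrad f z - hgrad h z) := fun z hz => by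
    have h1 : HasFDerivAt (fun z => f z - h z - ε) (fderiv ℝ f z - fderiv ℝ h z) z :=
      (((hfz z hz).differentiableAt (by simp)).hasFDerivAt.sub
        ((hhz z hz).differentiableAt (by simp)).hasFDerivAt).sub_const ε
    have h2 := (contDiffAt_max_zero_sq (f z - h z - ε)).2.comp_hasFDerivAt z h1
    have h3 : fderiv ℝ φ z = (2 * w z) • (fderiv ℝ f z - fderiv ℝ h z) :=
      (h2.congr_of_eventuallyEq (hφU z hz)).fderiv
    ext k
    simp [hgrad_apply, h3]
  have key : ∀ (g : Heis n → ℝ), ContDiffOn ℝ 1 g U → Continuous (energy p g φ) := by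
    intro g hg
    refine continuous_iff_continuousAt.2 fun z => ?_
    by_cases hz : z ∈ K
    · have h1 := (continuous_rpow_norm_smul hp).continuousAt.comp
        (continuousAt_hgrad (hg.contDiffAt (hU.mem_nhds (hKU hz))))
      have h2 := ContinuousAt.inner (𝕜 := ℝ) h1 (continuousAt_hgrad hφ1.contDiffAt)
      refine h2.congr (Eventually.of_forall fun y => ?_)
      simp [energy, inner_smul_left]
    · refine (continuousAt_const (y := (0 : ℝ))).congr ?_
      filter_upwards [hKc.isOpen_compl.mem_nhds hz] with y hy
      exact (energy_eq_zero_of_notMem fun h => hy (hsupp h)).symm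
  have kcs : ∀ (g : Heis n → ℝ), HasCompactSupport (energy p g φ) := fun g =>
    HasCompactSupport.of_support_subset_isCompact hKcomp fun z hz => by
      by_contra h
      exact hz (energy_eq_zero_of_notMem fun h' => h (hsupp h'))
  have hnonneg : ∀ z, 0 ≤ φ z := fun z => by
    simp only [hφ]; split_ifs <;> positivity
  have i1 := hf φ hφ1 hcs (hsupp.trans hKU) hnonneg
  have i2 := hh φ hφ1 hcs (hsupp.trans hKU) hnonneg
  have e2 : ∀ z, energy p (fun z => -h z) φ z = -energy p h φ z := fun z => by
    simp [energy, hgrad_neg]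
  simp only [e2, integral_neg] at i2
  have i3 : ∫ z, (energy p f φ z - energy p h φ z) ≤ 0 := by
    rw [integral_sub ((key f hf1).integrable_of_hasCompactSupport (kcs f))
      ((key h hh1).integrable_of_hasCompactSupport (kcs h))]
    linarith
  have form : ∀ z ∈ U, energy p f φ z - energy p h φ z = 2 * w z *
      inner ℝ (‖hgrad f z‖ ^ (p - 2) • hgrad f z - ‖hgrad h z‖ ^ (p - 2) • hgrad h z)
        (hgrad f z - hgrad h z) := fun z hz => by
    simp only [energy, hgr z hz, inner_smul_right, inner_sub_left, real_inner_smul_left]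
    ring
  have hw0 : ∀ z, 0 ≤ w z := fun z => le_max_right _ _
  have dnn : ∀ z, 0 ≤ energy p f φ z - energy p h φ z := fun z => by
    by_cases hz : z ∈ K
    · rw [form z (hKU hz)]
      by_cases hab : hgrad f z = hgrad h z
      · simp [hab]
      · exact mul_nonneg (by have := hw0 z; positivity) (inner_rpow_norm_smul_sub_pos hp hab).le
    · rw [energy_eq_zero_of_notMem fun h => hz (hsupp h),
        energy_eq_zero_of_notMem fun h => hz (hsupp h), sub_zero]
  have dzero : ∀ z, energy p f φ z - energy p h φ z = 0 := by
    by_contra! hne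
    obtain ⟨z, hz⟩ := hne
    have := Continuous.integral_pos_of_hasCompactSupport_nonneg_nonzero (μ := volume)
      ((key f hf1).sub (key h hh1)) ((kcs f).sub (kcs h)) dnn hz
    exact absurd i3 (not_le.2 this)
  have hgz : ∀ z, hgrad φ z = 0 := fun z => by
    by_cases hz : z ∈ K
    · rw [hgr z (hKU hz)]
      by_cases hab : hgrad f z = hgrad h z
      · simp [hab]
      · have h1 := dzero z
        rw [form z (hKU hz)] at h1
        have h2 := (inner_rpow_norm_smul_sub_pos hp hab).ne'
        have h3 : 2 * w z = 0 := by
          rcases mul_eq_zero.1 h1 with h | h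
          · exact h
          · exact absurd h h2
        rw [h3, zero_smul]
    · exact hgrad_eq_zero_of_notMem fun h => hz (hsupp h)
  have h0 := eq_zero_of_hgrad_eq_zero hn hφ1 hcs hgz z₀
  have h1 : 0 < w z₀ := lt_max_of_lt_left (by rw [hε]; linarith)
  simp only [hφ, if_pos hz₀] at h0
  have := pow_pos h1 2
  linarith

/-! ### Coordinates -/

/-- The coordinates of `ℍⁿ`, sorted by kind. -/
def coord (n : ℕ) : (Fin n ⊕ Fin n) ⊕ Unit ≃ Fin (2 * n + 1) :=
  Equiv.ofBijective (Sum.elim (Sum.elim (xIdx n) (yIdx n)) fun _ => tIdx n) <| by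
    rw [Fintype.bijective_iff_injective_and_card]
    refine ⟨?_, by simp; omega⟩
    rintro ((⟨i, hi⟩ | ⟨i, hi⟩) | i) ((⟨j, hj⟩ | ⟨j, hj⟩) | j) h <;>
      simp [xIdx, yIdx, tIdx] at h ⊢ <;> omega

lemma forall_coord {P : Fin (2 * n + 1) → Prop} (hx : ∀ i, P (xIdx n i))
    (hy : ∀ i, P (yIdx n i)) (ht : P (tIdx n)) (k : Fin (2 * n + 1)) : P k := by
  obtain ⟨((i | i) | i), rfl⟩ := (coord n).surjective k
  · exact hx i
  · exact hy i
  · exact ht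

lemma ext_coord {z w : Heis n} (hx : ∀ i, z (xIdx n i) = w (xIdx n i))
    (hy : ∀ i, z (yIdx n i) = w (yIdx n i)) (ht : z (tIdx n) = w (tIdx n)) : z = w :=
  funext (forall_coord hx hy ht)

lemma sum_coord {M : Type*} [AddCommMonoid M] (F : Fin (2 * n + 1) → M) :
    ∑ k, F k = ∑ i : Fin n, (F (xIdx n i) + F (yIdx n i)) + F (tIdx n) := by
  rw [← (coord n).sum_comp]
  simp only [Fintype.sum_sum_type, Finset.sum_add_distrib, Fintype.sum_unique]
  rfl

lemma xIdx_ne (i : Fin n) : ((xIdx n i : Fin (2 * n + 1)) : ℕ) ≠ 2 * n := by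
  have := i.isLt
  simp only [xIdx]
  omega

lemma yIdx_ne (i : Fin n) : ((yIdx n i : Fin (2 * n + 1)) : ℕ) ≠ 2 * n := by
  have := i.isLt
  simp only [yIdx]
  omega

lemma tIdx_val : ((tIdx n : Fin (2 * n + 1)) : ℕ) = 2 * n := rfl

lemma xIdx_ne_yIdx (i j : Fin n) : xIdx n i ≠ yIdx n j := fun h =>
  Sum.inl_ne_inr (Sum.inl_injective ((coord n).injective h))

lemma xIdx_ne_tIdx (i : Fin n) : xIdx n i ≠ tIdx n := fun h =>
  Sum.inl_ne_inr ((coord n).injective (a₁ := .inl (.inl i)) (a₂ := .inr ()) h)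

lemma yIdx_ne_tIdx (i : Fin n) : yIdx n i ≠ tIdx n := fun h =>
  Sum.inl_ne_inr ((coord n).injective (a₁ := .inl (.inr i)) (a₂ := .inr ()) h)

lemma xIdx_inj {i j : Fin n} : xIdx n i = xIdx n j ↔ i = j := by
  refine ⟨fun h => ?_, fun h => h ▸ rfl⟩
  exact Sum.inl_injective (Sum.inl_injective ((coord n).injective h))

lemma yIdx_inj {i j : Fin n} : yIdx n i = yIdx n j ↔ i = j := by
  refine ⟨fun h => ?_, fun h => h ▸ rfl⟩
  exact Sum.inr_injective (Sum.inl_injective ((coord n).injective h))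

/-! ### Group structure, dilations and gauge -/

@[simp] lemma mul_x (z w : Heis n) (i : Fin n) :
    mul z w (xIdx n i) = z (xIdx n i) + w (xIdx n i) := by simp [mul, xIdx_ne]

@[simp] lemma mul_y (z w : Heis n) (i : Fin n) :
    mul z w (yIdx n i) = z (yIdx n i) + w (yIdx n i) := by simp [mul, yIdx_ne]

@[simp] lemma mul_t (z w : Heis n) : mul z w (tIdx n) = z (tIdx n) + w (tIdx n) +
    2 * ∑ i : Fin n, (w (xIdx n i) * z (yIdx n i) - z (xIdx n i) * w (yIdx n i)) := by
  simp [mul, tIdx_val]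

@[simp] lemma inv_apply (z : Heis n) (k : Fin (2 * n + 1)) : inv z k = -z k := rfl

@[simp] lemma dil_x (s : ℝ) (z : Heis n) (i : Fin n) :
    dil s z (xIdx n i) = Real.exp s * z (xIdx n i) := by simp [dil, xIdx_ne]

@[simp] lemma dil_y (s : ℝ) (z : Heis n) (i : Fin n) :
    dil s z (yIdx n i) = Real.exp s * z (yIdx n i) := by simp [dil, yIdx_ne]

@[simp] lemma dil_t (s : ℝ) (z : Heis n) :
    dil s z (tIdx n) = Real.exp (2 * s) * z (tIdx n) := by simp [dil, tIdx_val]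

@[simp] lemma Zvf_x (z : Heis n) (i : Fin n) : Zvf z (xIdx n i) = z (xIdx n i) := by
  simp [Zvf, xIdx_ne]

@[simp] lemma Zvf_y (z : Heis n) (i : Fin n) : Zvf z (yIdx n i) = z (yIdx n i) := by
  simp [Zvf, yIdx_ne]

@[simp] lemma Zvf_t (z : Heis n) : Zvf z (tIdx n) = 2 * z (tIdx n) := by simp [Zvf, tIdx_val]

lemma mul_assoc' (a b c : Heis n) : mul (mul a b) c = mul a (mul b c) := by
  refine ext_coord (fun i => ?_) (fun i => ?_) ?_
  · simp; ring
  · simp; ring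
  · simp only [mul_t, mul_x, mul_y, Finset.mul_sum]
    have : ∀ S₁ S₂ S₃ S₄ x y w : ℝ, S₁ + S₂ = S₃ + S₄ →
        x + y + S₁ + w + S₂ = x + (y + w + S₃) + S₄ := fun _ _ _ _ _ _ _ h => by linarith
    apply this
    rw [← Finset.sum_add_distrib, ← Finset.sum_add_distrib]
    exact Finset.sum_congr rfl fun i _ => by ring

lemma inv_mul_self (a : Heis n) : mul (inv a) a = 0 := by
  refine ext_coord (fun i => ?_) (fun i => ?_) ?_
  · simp
  · simp
  · simp only [mul_t, inv_apply, Pi.zero_apply]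
    rw [Finset.sum_eq_zero fun i _ => by ring]
    ring

lemma mul_inv_self (a : Heis n) : mul a (inv a) = 0 := by
  refine ext_coord (fun i => ?_) (fun i => ?_) ?_
  · simp
  · simp
  · simp only [mul_t, inv_apply, Pi.zero_apply]
    rw [Finset.sum_eq_zero fun i _ => by ring]
    ring

lemma zero_mul' (a : Heis n) : mul 0 a = a := by
  refine ext_coord (fun i => ?_) (fun i => ?_) ?_ <;> simp

lemma mul_zero' (a : Heis n) : mul a 0 = a := by
  refine ext_coord (fun i => ?_) (fun i => ?_) ?_ <;> simp

lemma inv_mul_cancel_left' (a z : Heis n) : mul (inv a) (mul a z) = z := by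
  rw [← mul_assoc', inv_mul_self, zero_mul']

lemma mul_inv_cancel_left' (a z : Heis n) : mul a (mul (inv a) z) = z := by
  rw [← mul_assoc', mul_inv_self, zero_mul']

lemma inv_inv' (a : Heis n) : inv (inv a) = a := by
  ext k; simp

lemma inv_mul_rev (a b : Heis n) : inv (mul a b) = mul (inv b) (inv a) := by
  refine ext_coord (fun i => ?_) (fun i => ?_) ?_
  · simp [add_comm]
  · simp [add_comm]
  · simp only [mul_t, inv_apply, Finset.mul_sum, neg_add, ← Finset.sum_neg_distrib]
    have : ∀ S₁ S₂ x y : ℝ, S₁ = S₂ → -x + -y + S₁ = -y + -x + S₂ := fun _ _ _ _ h => by linarith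
    apply this
    exact Finset.sum_congr rfl fun i _ => by ring

lemma dil_mul (s : ℝ) (a b : Heis n) : dil s (mul a b) = mul (dil s a) (dil s b) := by
  refine ext_coord (fun i => ?_) (fun i => ?_) ?_
  · simp; ring
  · simp; ring
  · simp only [mul_t, dil_t, dil_x, dil_y, mul_add, Finset.mul_sum, two_mul s, Real.exp_add]
    congr 1
    exact Finset.sum_congr rfl fun i _ => by ring

lemma dil_inv (s : ℝ) (a : Heis n) : dil s (inv a) = inv (dil s a) := by
  refine ext_coord (fun i => ?_) (fun i => ?_) ?_ <;> simp

lemma dil_dil (s t : ℝ) (z : Heis n) : dil s (dil t z) = dil (s + t) z := by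
  refine ext_coord (fun i => ?_) (fun i => ?_) ?_
  · simp [Real.exp_add]; ring
  · simp [Real.exp_add]; ring
  · simp [mul_add, Real.exp_add]; ring

lemma dil_zero_left (z : Heis n) : dil 0 z = z := by
  refine ext_coord (fun i => ?_) (fun i => ?_) ?_ <;> simp

lemma dil_neg_dil (s : ℝ) (z : Heis n) : dil (-s) (dil s z) = z := by
  rw [dil_dil, neg_add_cancel, dil_zero_left]

lemma dil_dil_neg (s : ℝ) (z : Heis n) : dil s (dil (-s) z) = z := by
  rw [dil_dil, add_neg_cancel, dil_zero_left]

@[fun_prop]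
lemma _root_.Continuous.heis_mul {X : Type*} [TopologicalSpace X] {f g : X → Heis n}
    (hf : Continuous f) (hg : Continuous g) : Continuous fun x => mul (f x) (g x) := by
  refine continuous_pi (forall_coord (fun i => ?_) (fun i => ?_) ?_)
  · simp only [mul_x]; fun_prop
  · simp only [mul_y]; fun_prop
  · simp only [mul_t]; fun_prop

@[fun_prop]
lemma _root_.Continuous.heis_inv {X : Type*} [TopologicalSpace X] {f : X → Heis n}
    (hf : Continuous f) : Continuous fun x => inv (f x) := by
  refine continuous_pi fun k => ?_
  simp only [inv_apply]; fun_prop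

@[fun_prop]
lemma _root_.Continuous.heis_dil {X : Type*} [TopologicalSpace X] {s : X → ℝ} {f : X → Heis n}
    (hs : Continuous s) (hf : Continuous f) : Continuous fun x => dil (s x) (f x) := by
  refine continuous_pi (forall_coord (fun i => ?_) (fun i => ?_) ?_)
  · simp only [dil_x]; fun_prop
  · simp only [dil_y]; fun_prop
  · simp only [dil_t]; fun_prop

@[fun_prop]
lemma _root_.Continuous.heis_Zvf {X : Type*} [TopologicalSpace X] {f : X → Heis n}
    (hf : Continuous f) : Continuous fun x => Zvf (f x) := by
  refine continuous_pi (forall_coord (fun i => ?_) (fun i => ?_) ?_)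
  · simp only [Zvf_x]; fun_prop
  · simp only [Zvf_y]; fun_prop
  · simp only [Zvf_t]; fun_prop

lemma hasDerivAt_dil (z : Heis n) (s : ℝ) :
    HasDerivAt (fun s => dil s z) (Zvf (dil s z)) s := by
  rw [hasDerivAt_pi]
  refine forall_coord (fun i => ?_) (fun i => ?_) ?_
  · simpa using (Real.hasDerivAt_exp s).mul_const (z (xIdx n i))
  · simpa using (Real.hasDerivAt_exp s).mul_const (z (yIdx n i))
  · have h := (((hasDerivAt_id s).const_mul 2).exp).mul_const (z (tIdx n))
    simp only [dil_t, Zvf_t]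
    exact h.congr_deriv (by simp only [id]; ring)

/-- The squared Euclidean norm of the horizontal coordinates. -/
def horSq (z : Heis n) : ℝ := ∑ i : Fin n, (z (xIdx n i) ^ 2 + z (yIdx n i) ^ 2)

/-- The fourth power of the Koranyi gauge. -/
def gauge4 (z : Heis n) : ℝ := horSq z ^ 2 + z (tIdx n) ^ 2

lemma horSq_nonneg (z : Heis n) : 0 ≤ horSq z := Finset.sum_nonneg fun i _ => by positivity

lemma gauge4_nonneg (z : Heis n) : 0 ≤ gauge4 z := by unfold gauge4; positivity

lemma gauge4_zero : gauge4 (0 : Heis n) = 0 := by simp [gauge4, horSq]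

lemma abs_apply_le (z : Heis n) (k : Fin (2 * n + 1)) : |z k| ≤ gauge4 z + 2 := by
  have key : ∀ a b : ℝ, a ^ 2 ≤ b → |a| ≤ b + 1 := fun a b h => by
    rw [abs_le]; constructor <;> nlinarith [sq_nonneg (a - 1), sq_nonneg (a + 1)]
  have h1 : horSq z ≤ gauge4 z + 1 := by
    unfold gauge4; nlinarith [sq_nonneg (horSq z - 1), sq_nonneg (z (tIdx n))]
  have hi : ∀ i, z (xIdx n i) ^ 2 + z (yIdx n i) ^ 2 ≤ horSq z := fun i =>
    Finset.single_le_sum (f := fun i => z (xIdx n i) ^ 2 + z (yIdx n i) ^ 2)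
      (fun j _ => by positivity) (Finset.mem_univ i)
  revert k
  refine forall_coord (fun i => ?_) (fun i => ?_) ?_
  · have := key (z (xIdx n i)) (gauge4 z + 1) (by nlinarith [hi i, sq_nonneg (z (yIdx n i))])
    linarith
  · have := key (z (yIdx n i)) (gauge4 z + 1) (by nlinarith [hi i, sq_nonneg (z (xIdx n i))])
    linarith
  · have := key (z (tIdx n)) (gauge4 z) (by unfold gauge4; nlinarith [sq_nonneg (horSq z)])
    linarith

lemma gauge4_pos {z : Heis n} (hz : z ≠ 0) : 0 < gauge4 z := by
  refine (gauge4_nonneg z).lt_of_ne fun h => hz ?_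
  have ht : z (tIdx n) ^ 2 = 0 := by
    unfold gauge4 at h; nlinarith [sq_nonneg (horSq z), sq_nonneg (z (tIdx n))]
  have hr : horSq z = 0 := by
    unfold gauge4 at h; rw [ht] at h; simpa using h.symm
  have hi : ∀ i, z (xIdx n i) ^ 2 + z (yIdx n i) ^ 2 = 0 := fun i =>
    (Finset.sum_eq_zero_iff_of_nonneg fun j _ => by positivity).1 hr i (Finset.mem_univ i)
  refine ext_coord (fun i => ?_) (fun i => ?_) (by simpa using ht)
  · have : z (xIdx n i) ^ 2 = 0 := by
      nlinarith [hi i, sq_nonneg (z (xIdx n i)), sq_nonneg (z (yIdx n i))]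
    simpa using this
  · have : z (yIdx n i) ^ 2 = 0 := by
      nlinarith [hi i, sq_nonneg (z (xIdx n i)), sq_nonneg (z (yIdx n i))]
    simpa using this

lemma gauge4_inv (z : Heis n) : gauge4 (inv z) = gauge4 z := by simp [gauge4, horSq]

lemma horSq_dil (s : ℝ) (z : Heis n) : horSq (dil s z) = Real.exp (2 * s) * horSq z := by
  simp only [horSq, dil_x, dil_y, Finset.mul_sum, two_mul s, Real.exp_add]
  exact Finset.sum_congr rfl fun i _ => by ring

lemma gauge4_dil (s : ℝ) (z : Heis n) : gauge4 (dil s z) = Real.exp (4 * s) * gauge4 z := by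
  simp only [gauge4, horSq_dil, dil_t, show 4 * s = 2 * s + 2 * s by ring, Real.exp_add]
  ring

@[fun_prop]
lemma contDiff_horSq {m : WithTop ℕ∞} : ContDiff ℝ m (horSq : Heis n → ℝ) := by
  unfold horSq; fun_prop

@[fun_prop]
lemma contDiff_gauge4 {m : WithTop ℕ∞} : ContDiff ℝ m (gauge4 : Heis n → ℝ) := by
  unfold gauge4; fun_prop

@[fun_prop]
lemma continuous_gauge4 : Continuous (gauge4 : Heis n → ℝ) := contDiff_gauge4.continuous (n := 0)

@[fun_prop]
lemma continuous_horSq : Continuous (horSq : Heis n → ℝ) := contDiff_horSq.continuous (n := 0)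

lemma isCompact_gauge4_le (M : ℝ) : IsCompact {z : Heis n | gauge4 z ≤ M} := by
  refine Metric.isCompact_of_isClosed_isBounded (isClosed_le continuous_gauge4 continuous_const) ?_
  refine isBounded_iff_forall_norm_le.2 ⟨|M| + 2, fun z hz => ?_⟩
  refine (pi_norm_le_iff_of_nonneg (by positivity)).2 fun k => ?_
  have h1 : gauge4 z ≤ M := hz
  have := abs_apply_le z k
  have := le_abs_self M
  rw [Real.norm_eq_abs]
  linarith

lemma mem_gaugeBall {z w : Heis n} {R : ℝ} (hR : 0 < R) :
    w ∈ gaugeBall z R ↔ gauge4 (mul (inv z) w) < R ^ 4 := by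
  have h1 : inv (mul (inv w) z) = mul (inv z) w := by rw [inv_mul_rev, inv_inv']
  have h2 : rho (mul (inv w) z) = gauge4 (mul (inv w) z) ^ ((1 : ℝ) / 4) := rfl
  have h3 : (R ^ 4) ^ ((1 : ℝ) / 4) = R := by
    rw [← Real.rpow_natCast, ← Real.rpow_mul hR.le]; norm_num
  rw [gaugeBall, mem_ofPred_eq, h2, ← h1, gauge4_inv]
  conv_lhs => rw [← h3]
  exact Real.rpow_lt_rpow_iff (gauge4_nonneg _) (by positivity) (by norm_num)

/-! ### Left translations and dilations act on weak subsolutions -/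

/-- An affine automorphism of `ℝ^(2n+1)` mapping the horizontal frame to a multiple of itself. -/
structure FrameMap (n : ℕ) where
  /-- The linear part. -/
  lin : Heis n ≃L[ℝ] Heis n
  /-- The translation part. -/
  shift : Heis n
  /-- The scaling factor. -/
  scale : ℝ
  scale_pos : 0 < scale
  map_frame : ∀ z k, lin (frame z k) = scale • frame (lin z + shift) k

namespace FrameMap

/-- The action on points. -/
def toHomeo (Φ : FrameMap n) : Heis n ≃ₜ Heis n :=
  Φ.lin.toHomeomorph.trans (Homeomorph.addRight Φ.shift)

lemma toHomeo_apply (Φ : FrameMap n) (z : Heis n) : Φ.toHomeo z = Φ.lin z + Φ.shift := rfl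

lemma toHomeo_symm_apply (Φ : FrameMap n) (z : Heis n) :
    Φ.toHomeo.symm z = Φ.lin.symm (z - Φ.shift) := by
  apply Φ.toHomeo.injective
  rw [Homeomorph.apply_symm_apply, toHomeo_apply]
  simp

lemma contDiff_toHomeo (Φ : FrameMap n) {m : WithTop ℕ∞} : ContDiff ℝ m Φ.toHomeo :=
  (Φ.lin.contDiff.add contDiff_const : ContDiff ℝ m fun z => Φ.lin z + Φ.shift)

lemma contDiff_toHomeo_symm (Φ : FrameMap n) {m : WithTop ℕ∞} :
    ContDiff ℝ m Φ.toHomeo.symm := by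
  have : (Φ.toHomeo.symm : Heis n → Heis n) = fun z => Φ.lin.symm (z - Φ.shift) :=
    funext Φ.toHomeo_symm_apply
  rw [this]
  exact Φ.lin.symm.contDiff.comp (contDiff_id.sub contDiff_const)

lemma hgrad_comp (Φ : FrameMap n) {f : Heis n → ℝ} {z : Heis n}
    (hf : DifferentiableAt ℝ f (Φ.toHomeo z)) :
    hgrad (fun w => f (Φ.toHomeo w)) z = Φ.scale • hgrad f (Φ.toHomeo z) := by
  have h1 : HasFDerivAt Φ.toHomeo (Φ.lin : Heis n →L[ℝ] Heis n) z :=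
    Φ.lin.hasFDerivAt.add_const Φ.shift
  have h2 := (hf.hasFDerivAt.comp z h1).fderiv
  ext k
  have h3 : fderiv ℝ (fun w => f (Φ.toHomeo w)) z (frame z k) =
      fderiv ℝ f (Φ.toHomeo z) (Φ.lin (frame z k)) := by
    have := congrArg (fun L => L (frame z k)) h2
    exact this
  rw [hgrad_apply, h3, Φ.map_frame, map_smul]
  rfl

lemma exists_integral_comp (Φ : FrameMap n) :
    ∃ κ : ℝ, 0 ≤ κ ∧ ∀ g : Heis n → ℝ, ∫ z, g (Φ.toHomeo z) = κ * ∫ z, g z := by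
  have hdet : LinearMap.det (Φ.lin : Heis n →ₗ[ℝ] Heis n) ≠ 0 :=
    (LinearEquiv.isUnit_det' Φ.lin.toLinearEquiv).ne_zero
  have hmap := Measure.map_linearMap_addHaar_eq_smul_addHaar (volume : Measure (Heis n)) hdet
  refine ⟨|(LinearMap.det (Φ.lin : Heis n →ₗ[ℝ] Heis n))⁻¹|, abs_nonneg _, fun g => ?_⟩
  have h1 : ∫ z, g (Φ.toHomeo z) =
      ∫ y, g (y + Φ.shift) ∂(volume.map (Φ.lin : Heis n →ₗ[ℝ] Heis n)) :=
    (Φ.lin.toHomeomorph.measurableEmbedding.integral_map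
      (μ := volume) (fun y => g (y + Φ.shift))).symm
  rw [h1, hmap, integral_smul_measure, integral_add_right_eq_self,
    ENNReal.toReal_ofReal (abs_nonneg _), smul_eq_mul]

lemma weakSub_comp (Φ : FrameMap n) {p : ℝ} {f : Heis n → ℝ} {U : Set (Heis n)}
    (hf : WeakSub p f U) (hU : IsOpen U) (hf1 : ContDiffOn ℝ 1 f U) :
    WeakSub p (fun z => f (Φ.toHomeo z)) (Φ.toHomeo ⁻¹' U) := by
  intro φ hφ hc hs h0
  set ψ : Heis n → ℝ := fun z => φ (Φ.toHomeo.symm z) with hψ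
  have hψ1 : ContDiff ℝ 1 ψ := hφ.comp Φ.contDiff_toHomeo_symm
  have hψs : tsupport ψ = Φ.toHomeo.symm ⁻¹' tsupport φ :=
    tsupport_comp_eq_preimage φ Φ.toHomeo.symm
  have hψc : HasCompactSupport ψ := hc.comp_homeomorph Φ.toHomeo.symm
  have hψU : tsupport ψ ⊆ U := by
    rw [hψs]
    intro z hz
    have := hs hz
    simpa using this
  have hφψ : φ = fun z => ψ (Φ.toHomeo z) := by
    ext z; simp [hψ]
  have key : ∀ z, energy p (fun z => f (Φ.toHomeo z)) φ z =
      Φ.scale ^ (p - 2) * Φ.scale * Φ.scale * energy p f ψ (Φ.toHomeo z) := fun z => by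
    by_cases hz : Φ.toHomeo z ∈ U
    · have hd := (hf1.contDiffAt (hU.mem_nhds hz)).differentiableAt (by simp)
      conv_lhs => rw [hφψ]
      simp only [energy, Φ.hgrad_comp hd,
        Φ.hgrad_comp (hψ1.differentiable (by simp) _), norm_smul, real_inner_smul_left,
        inner_smul_right, Real.norm_eq_abs, abs_of_pos Φ.scale_pos,
        Real.mul_rpow Φ.scale_pos.le (norm_nonneg _)]
      ring
    · rw [energy_eq_zero_of_notMem fun h => hz (hs h),
        energy_eq_zero_of_notMem fun h => hz (hψU h), mul_zero]
  obtain ⟨κ, hκ, hint⟩ := Φ.exists_integral_comp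
  simp only [key, integral_const_mul, hint]
  have := Φ.scale_pos
  exact mul_nonpos_of_nonneg_of_nonpos (by positivity) (mul_nonpos_of_nonneg_of_nonpos hκ
    (hf ψ hψ1 hψc hψU fun z => h0 _))

end FrameMap

@[simp] lemma frame_inl_x (z : Heis n) (i j : Fin n) :
    frame z (.inl i) (xIdx n j) = if j = i then 1 else 0 := by
  simp [frame, Pi.single_apply, xIdx_inj, xIdx_ne_tIdx]

@[simp] lemma frame_inl_y (z : Heis n) (i j : Fin n) :
    frame z (.inl i) (yIdx n j) = 0 := by
  simp [frame, (xIdx_ne_yIdx _ _).symm, yIdx_ne_tIdx]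

@[simp] lemma frame_inl_t (z : Heis n) (i : Fin n) :
    frame z (.inl i) (tIdx n) = 2 * z (yIdx n i) := by
  simp [frame, (xIdx_ne_tIdx _).symm]

@[simp] lemma frame_inr_x (z : Heis n) (i j : Fin n) :
    frame z (.inr i) (xIdx n j) = 0 := by
  simp [frame, xIdx_ne_yIdx, xIdx_ne_tIdx]

@[simp] lemma frame_inr_y (z : Heis n) (i j : Fin n) :
    frame z (.inr i) (yIdx n j) = if j = i then 1 else 0 := by
  simp [frame, Pi.single_apply, yIdx_inj, yIdx_ne_tIdx]

@[simp] lemma frame_inr_t (z : Heis n) (i : Fin n) :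
    frame z (.inr i) (tIdx n) = -(2 * z (xIdx n i)) := by
  simp [frame, (yIdx_ne_tIdx _).symm]

/-- The linear part of the left translation by `a`. -/
def transLin (a : Heis n) : Heis n →ₗ[ℝ] Heis n where
  toFun z := mul a z - a
  map_add' z w := by
    refine ext_coord (fun i => ?_) (fun i => ?_) ?_
    · simp
    · simp
    · simp only [Pi.sub_apply, Pi.add_apply, mul_t]
      have : ∀ S S₁ S₂ x y t : ℝ, S = S₁ + S₂ →
        x + (y + t) + 2 * S - x = (x + y + 2 * S₁ - x) + (x + t + 2 * S₂ - x) :=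
        fun _ _ _ _ _ _ h => by rw [h]; ring
      apply this
      rw [← Finset.sum_add_distrib]
      exact Finset.sum_congr rfl fun i _ => by ring
  map_smul' c z := by
    refine ext_coord (fun i => ?_) (fun i => ?_) ?_
    · simp
    · simp
    · simp only [Pi.sub_apply, Pi.smul_apply, mul_t, smul_eq_mul, RingHom.id_apply]
      have : ∀ S S₁ x y : ℝ, S = c * S₁ →
        x + c * y + 2 * S - x = c * (x + y + 2 * S₁ - x) := fun _ _ _ _ h => by rw [h]; ring
      apply this
      rw [Finset.mul_sum]
      exact Finset.sum_congr rfl fun i _ => by ring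

lemma transLin_apply (a z : Heis n) : transLin a z = mul a z - a := rfl

lemma transLin_transLin_inv (a z : Heis n) : transLin a (transLin (inv a) z) = z := by
  have h : ∀ b w : Heis n, transLin b w = w +
      (2 * ∑ i : Fin n, (w (xIdx n i) * b (yIdx n i) - b (xIdx n i) * w (yIdx n i))) •
        Pi.single (tIdx n) 1 := fun b w => by
    refine ext_coord (fun i => ?_) (fun i => ?_) ?_
    · simp [transLin_apply, xIdx_ne_tIdx]
    · simp [transLin_apply, yIdx_ne_tIdx]
    · simp [transLin_apply]; ring
  rw [h, h (inv a)]
  refine ext_coord (fun i => ?_) (fun i => ?_) ?_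
  · simp [xIdx_ne_tIdx]
  · simp [yIdx_ne_tIdx]
  · simp only [Pi.add_apply, Pi.smul_apply, Pi.single_eq_same, inv_apply, smul_eq_mul, mul_one,
      Pi.single_eq_of_ne (xIdx_ne_tIdx _), Pi.single_eq_of_ne (yIdx_ne_tIdx _), mul_zero, add_zero]
    have : ∀ S₁ S₂ x : ℝ, S₁ = -S₂ → x + 2 * S₁ + 2 * S₂ = x := fun _ _ _ h => by rw [h]; ring
    apply this
    rw [← Finset.sum_neg_distrib]
    exact Finset.sum_congr rfl fun i _ => by ring

/-- Left translation by `a`. -/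
def trans (a : Heis n) : FrameMap n where
  lin := LinearEquiv.toContinuousLinearEquiv
    { transLin a with
      invFun := transLin (inv a)
      left_inv := fun z => by
        have := transLin_transLin_inv (inv a) z
        rwa [inv_inv'] at this
      right_inv := fun z => transLin_transLin_inv a z }
  shift := a
  scale := 1
  scale_pos := one_pos
  map_frame z k := by
    change mul a (frame z k) - a = (1 : ℝ) • frame (mul a z - a + a) k
    rcases k with j | j
    · refine ext_coord (fun i => ?_) (fun i => ?_) ?_
      · simp
      · simp
      · simp; ring
    · refine ext_coord (fun i => ?_) (fun i => ?_) ?_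
      · simp
      · simp
      · simp; ring

lemma trans_apply (a z : Heis n) : (trans a).toHomeo z = mul a z := by
  change mul a z - a + a = mul a z
  simp

/-- The dilation by `exp s`. -/
def dilMap (s : ℝ) : FrameMap n where
  lin := LinearEquiv.toContinuousLinearEquiv
    { toFun := dil s
      map_add' := fun z w => by
        refine ext_coord (fun i => ?_) (fun i => ?_) ?_ <;> simp <;> ring
      map_smul' := fun c z => by
        refine ext_coord (fun i => ?_) (fun i => ?_) ?_ <;> simp <;> ring
      invFun := dil (-s)
      left_inv := dil_neg_dil s
      right_inv := dil_dil_neg s }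
  shift := 0
  scale := Real.exp s
  scale_pos := Real.exp_pos s
  map_frame z k := by
    change dil s (frame z k) = Real.exp s • frame (dil s z + 0) k
    rw [add_zero]
    rcases k with j | j
    · refine ext_coord (fun i => ?_) (fun i => ?_) ?_
      · simp
      · simp
      · simp [two_mul s, Real.exp_add]; ring
    · refine ext_coord (fun i => ?_) (fun i => ?_) ?_
      · simp
      · simp
      · simp [two_mul s, Real.exp_add]; ring

lemma dilMap_apply (s : ℝ) (z : Heis n) : (dilMap s).toHomeo z = dil s z := by
  change dil s z + 0 = dil s z
  simp

/-! ### Powers of the gauge as weak subsolutions -/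

lemma integral_fderiv_linear {ψ : Heis n → ℝ} (hψ : ContDiff ℝ 1 ψ) (hc : HasCompactSupport ψ)
    (B : Heis n →L[ℝ] Heis n) :
    ∫ z, fderiv ℝ ψ z (B z) = -(∑ k, B (Pi.single k 1) k) * ∫ z, ψ z := by
  have hexp : ∀ z, fderiv ℝ ψ z (B z) = ∑ k, B z k * fderiv ℝ ψ z (Pi.single k 1) := fun z => by
    conv_lhs => rw [pi_eq_sum_univ' (B z), map_sum]
    refine Finset.sum_congr rfl fun k _ => ?_
    rw [map_smul, smul_eq_mul]
  have hcd : ∀ k, Continuous fun z => fderiv ℝ ψ z (Pi.single k 1) := fun k =>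
    (hψ.continuous_fderiv (by simp)).clm_apply continuous_const
  have hcs : ∀ k, HasCompactSupport fun z => fderiv ℝ ψ z (Pi.single k (1 : ℝ)) := fun k =>
    hc.fderiv_apply (𝕜 := ℝ) _
  have hBk : ∀ k z, HasFDerivAt (fun z => B z k) ((ContinuousLinearMap.proj k).comp B) z :=
    fun k z => ((ContinuousLinearMap.proj (R := ℝ) (φ := fun _ => ℝ) k).comp B).hasFDerivAt
  have hBc : ∀ k, Continuous fun z => B z k := fun k => (continuous_apply k).comp B.continuous
  have hi : ∀ k, Integrable fun z => B z k * fderiv ℝ ψ z (Pi.single k 1) := fun k =>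
    ((hBc k).mul (hcd k)).integrable_of_hasCompactSupport ((hcs k).mul_left)
  have hd : ∀ k z, fderiv ℝ (fun z => B z k) z (Pi.single k 1) = B (Pi.single k 1) k :=
    fun k z => by rw [(hBk k z).fderiv]; rfl
  simp only [hexp]
  rw [integral_finsetSum _ fun k _ => hi k, neg_mul, Finset.sum_mul, ← Finset.sum_neg_distrib]
  refine Finset.sum_congr rfl fun k _ => ?_
  rw [integral_mul_fderiv_eq_neg_fderiv_mul_of_integrable]
  · simp only [hd, integral_const_mul]
  · simp only [hd]
    exact (hψ.continuous.integrable_of_hasCompactSupport hc).const_mul _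
  · exact hi k
  · exact ((hBc k).mul hψ.continuous).integrable_of_hasCompactSupport hc.mul_left
  · exact fun z _ => (hBk k z).differentiableAt
  · exact fun z _ => hψ.differentiable (by simp) z

/-- The dilation generator as a linear map. -/
def ZLin (n : ℕ) : Heis n →L[ℝ] Heis n :=
  LinearMap.toContinuousLinearMap
    { toFun := Zvf
      map_add' := fun z w => by
        refine ext_coord (fun i => ?_) (fun i => ?_) ?_ <;> simp [mul_add]
      map_smul' := fun c z => by
        refine ext_coord (fun i => ?_) (fun i => ?_) ?_ <;> simp [mul_left_comm] }

lemma ZLin_apply (z : Heis n) : ZLin n z = Zvf z := rfl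

lemma trace_ZLin : ∑ k, ZLin n (Pi.single k 1) k = 2 * n + 2 := by
  rw [sum_coord]
  simp [ZLin_apply]
  ring

/-- The generator of the rotations in the horizontal coordinates. -/
def rot (n : ℕ) : Heis n →L[ℝ] Heis n :=
  ∑ i : Fin n, ((ContinuousLinearMap.proj (yIdx n i)).smulRight (Pi.single (xIdx n i) 1) -
    (ContinuousLinearMap.proj (xIdx n i)).smulRight (Pi.single (yIdx n i) 1))

@[simp] lemma rot_x (z : Heis n) (i : Fin n) : rot n z (xIdx n i) = z (yIdx n i) := by
  simp [rot, Pi.single_apply, xIdx_inj, xIdx_ne_yIdx]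

@[simp] lemma rot_y (z : Heis n) (i : Fin n) : rot n z (yIdx n i) = -z (xIdx n i) := by
  simp [rot, Pi.single_apply, yIdx_inj, (xIdx_ne_yIdx _ _).symm]

@[simp] lemma rot_t (z : Heis n) : rot n z (tIdx n) = 0 := by
  simp [rot, (xIdx_ne_tIdx _).symm, (yIdx_ne_tIdx _).symm]

lemma trace_rot : ∑ k, rot n (Pi.single k 1) k = 0 := by
  rw [sum_coord]
  simp [(xIdx_ne_yIdx _ _), (xIdx_ne_yIdx _ _).symm]

lemma fderiv_horSq (z v : Heis n) : fderiv ℝ horSq z v =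
    2 * ∑ i : Fin n, (z (xIdx n i) * v (xIdx n i) + z (yIdx n i) * v (yIdx n i)) := by
  have hk : ∀ k : Fin (2 * n + 1), HasFDerivAt (fun z : Heis n => z k)
    (ContinuousLinearMap.proj k : Heis n →L[ℝ] ℝ) z := fun k => hasFDerivAt_apply k z
  have h := HasFDerivAt.fun_sum (u := Finset.univ) fun (i : Fin n) _ =>
    ((hk (xIdx n i)).pow 2).add ((hk (yIdx n i)).pow 2)
  have h' : fderiv ℝ horSq z = _ := h.fderiv
  rw [h', Finset.mul_sum]
  simp only [_root_.sum_apply]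
  refine Finset.sum_congr rfl fun i _ => ?_
  simp
  ring

lemma fderiv_gauge4 (z v : Heis n) : fderiv ℝ gauge4 z v =
    2 * horSq z * fderiv ℝ horSq z v + 2 * z (tIdx n) * v (tIdx n) := by
  have hk : HasFDerivAt (fun z : Heis n => z (tIdx n))
    (ContinuousLinearMap.proj (tIdx n) : Heis n →L[ℝ] ℝ) z := hasFDerivAt_apply _ z
  have hr : HasFDerivAt horSq (fderiv ℝ horSq z) z :=
    ((contDiff_horSq (m := 1)).differentiable (by simp) z).hasFDerivAt
  have h' : fderiv ℝ gauge4 z = _ := ((hr.pow 2).add (hk.pow 2)).fderiv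
  rw [h']
  simp

lemma fderiv_horSq_Zvf (z : Heis n) : fderiv ℝ horSq z (Zvf z) = 2 * horSq z := by
  rw [fderiv_horSq, horSq]
  congr 1
  exact Finset.sum_congr rfl fun i _ => by simp; ring

lemma fderiv_horSq_rot (z : Heis n) : fderiv ℝ horSq z (rot n z) = 0 := by
  rw [fderiv_horSq, Finset.sum_eq_zero fun i _ => by simp; ring, mul_zero]

lemma fderiv_gauge4_Zvf (z : Heis n) : fderiv ℝ gauge4 z (Zvf z) = 4 * gauge4 z := by
  rw [fderiv_gauge4, fderiv_horSq_Zvf, Zvf_t, gauge4]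
  ring

lemma fderiv_gauge4_rot (z : Heis n) : fderiv ℝ gauge4 z (rot n z) = 0 := by
  rw [fderiv_gauge4, fderiv_horSq_rot, rot_t]
  ring

lemma sum_hgrad_gauge4_frame (z : Heis n) :
    ∑ k, fderiv ℝ gauge4 z (frame z k) • frame z k =
      (4 * horSq z) • Zvf z + (4 * z (tIdx n)) • rot n z := by
  have hx : ∀ i, fderiv ℝ gauge4 z (frame z (.inl i)) =
      4 * horSq z * z (xIdx n i) + 4 * z (tIdx n) * z (yIdx n i) := fun i => by
    rw [fderiv_gauge4, fderiv_horSq]; simp; ring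
  have hy : ∀ i, fderiv ℝ gauge4 z (frame z (.inr i)) =
      4 * horSq z * z (yIdx n i) - 4 * z (tIdx n) * z (xIdx n i) := fun i => by
    rw [fderiv_gauge4, fderiv_horSq]; simp; ring
  rw [Fintype.sum_sum_type]
  refine ext_coord (fun i => ?_) (fun i => ?_) ?_
  · simp [hx]
  · simp [hy]; ring
  · simp only [Pi.add_apply, Finset.sum_apply, Pi.smul_apply, smul_eq_mul, hx, hy, frame_inl_t,
      frame_inr_t, Zvf_t, rot_t, mul_zero, add_zero]
    rw [← Finset.sum_add_distrib]
    have : ∀ i : Fin n, (4 * horSq z * z (xIdx n i) + 4 * z (tIdx n) * z (yIdx n i)) *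
        (2 * z (yIdx n i)) + (4 * horSq z * z (yIdx n i) - 4 * z (tIdx n) * z (xIdx n i)) *
        -(2 * z (xIdx n i)) = 8 * z (tIdx n) * (z (xIdx n i) ^ 2 + z (yIdx n i) ^ 2) :=
      fun i => by ring
    rw [Finset.sum_congr rfl fun i _ => this i, ← Finset.mul_sum]
    change _ * horSq z = _
    ring

/-- One quarter of the derivative of `φ` along the horizontal gradient of `gauge4`. -/
def gaugeDeriv (φ : Heis n → ℝ) (z : Heis n) : ℝ :=
  horSq z * fderiv ℝ φ z (Zvf z) + z (tIdx n) * fderiv ℝ φ z (rot n z)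

lemma inner_hgrad_gauge4 (φ : Heis n → ℝ) (z : Heis n) :
    inner ℝ (hgrad gauge4 z) (hgrad φ z) = 4 * gaugeDeriv φ z := by
  have h1 : inner ℝ (hgrad gauge4 z) (hgrad φ z) =
      fderiv ℝ φ z (∑ k, fderiv ℝ gauge4 z (frame z k) • frame z k) := by
    simp [PiLp.inner_apply, hgrad_apply, map_sum, mul_comm]
  rw [h1, sum_hgrad_gauge4_frame, gaugeDeriv]
  simp
  ring

lemma norm_hgrad_gauge4 (z : Heis n) :
    ‖hgrad gauge4 z‖ = √(16 * horSq z * gauge4 z) := by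
  rw [norm_eq_sqrt_real_inner, inner_hgrad_gauge4, gaugeDeriv, fderiv_gauge4_Zvf,
    fderiv_gauge4_rot]
  congr 1
  ring

lemma abs_gaugeDeriv_le (φ : Heis n → ℝ) (z : Heis n) :
    |gaugeDeriv φ z| ≤ √(horSq z) * √(gauge4 z) * ‖hgrad φ z‖ := by
  have h := abs_real_inner_le_norm (hgrad gauge4 z) (hgrad φ z)
  have h16 : √(16 : ℝ) = 4 := by
    rw [show (16 : ℝ) = 4 ^ 2 by norm_num, Real.sqrt_sq (by norm_num)]
  rw [inner_hgrad_gauge4, norm_hgrad_gauge4, mul_assoc, Real.sqrt_mul (by norm_num), h16,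
    Real.sqrt_mul (horSq_nonneg z), abs_mul, abs_of_pos (by norm_num : (0 : ℝ) < 4)] at h
  linarith

lemma gaugeDeriv_eq_zero {φ : Heis n → ℝ} {z : Heis n} (hz : z ∉ tsupport φ) :
    gaugeDeriv φ z = 0 := by
  have := abs_gaugeDeriv_le φ z
  rw [hgrad_eq_zero_of_notMem hz, norm_zero, mul_zero] at this
  exact abs_nonpos_iff.1 this

lemma continuous_gaugeDeriv {φ : Heis n → ℝ} (hφ : ContDiff ℝ 1 φ) :
    Continuous (gaugeDeriv φ) := by
  have h := hφ.continuous_fderiv (by simp)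
  exact (continuous_horSq.mul (h.clm_apply (ZLin n).continuous)).add
    ((continuous_apply _).mul (h.clm_apply (rot n).continuous))

/-- The regularized weight used to show that powers of the gauge are weak subsolutions. -/
def regWeight (q k ε : ℝ) (z : Heis n) : ℝ := (horSq z + ε) ^ q * gauge4 z ^ (-k)

lemma regWeight_nonneg (q k : ℝ) {ε : ℝ} (hε : 0 ≤ ε) (z : Heis n) : 0 ≤ regWeight q k ε z := by
  have := horSq_nonneg z
  have := gauge4_nonneg z
  unfold regWeight
  positivity

lemma contDiffAt_regWeight (q k : ℝ) {ε : ℝ} (hε : 0 < ε) {z : Heis n} (hz : z ≠ 0) :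
    ContDiffAt ℝ 1 (regWeight q k ε) z := by
  have := horSq_nonneg z
  refine ContDiffAt.mul ?_ ?_
  · exact (contDiff_horSq.contDiffAt.add contDiffAt_const).rpow_const_of_ne (by positivity)
  · exact contDiff_gauge4.contDiffAt.rpow_const_of_ne (gauge4_pos hz).ne'

lemma fderiv_regWeight (q k : ℝ) {ε : ℝ} (hε : 0 < ε) {z : Heis n} (hz : z ≠ 0) (v : Heis n) :
    fderiv ℝ (regWeight q k ε) z v = regWeight q k ε z *
      (q * fderiv ℝ horSq z v / (horSq z + ε) - k * fderiv ℝ gauge4 z v / gauge4 z) := by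
  have hr : 0 < horSq z + ε := by have := horSq_nonneg z; positivity
  have hN := gauge4_pos hz
  have h1 : HasFDerivAt horSq (fderiv ℝ horSq z) z :=
    ((contDiff_horSq (m := 1)).differentiable (by simp) z).hasFDerivAt
  have h2 : HasFDerivAt gauge4 (fderiv ℝ gauge4 z) z :=
    ((contDiff_gauge4 (m := 1)).differentiable (by simp) z).hasFDerivAt
  have h3 : HasFDerivAt (fun z => (horSq z + ε) ^ q) _ z :=
    (h1.add_const ε).rpow_const (p := q) (Or.inl hr.ne')
  have h4 : HasFDerivAt (fun z => gauge4 z ^ (-k)) _ z := h2.rpow_const (p := -k) (Or.inl hN.ne')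
  have h5 : fderiv ℝ (regWeight q k ε) z = _ := (h3.mul h4).fderiv
  rw [h5]
  simp only [_root_.add_apply, _root_.smul_apply, smul_eq_mul, regWeight,
    Real.rpow_sub_one hr.ne', Real.rpow_sub_one hN.ne']
  field_simp
  ring

/-- A function vanishing off a closed set and `C¹` near that set is `C¹`. -/
lemma contDiff_of_eq_zero_off {F : Heis n → ℝ} {K : Set (Heis n)} (hK : IsClosed K)
    (h0 : ∀ z, z ∉ K → F z = 0) (h : ∀ z ∈ K, ContDiffAt ℝ 1 F z) : ContDiff ℝ 1 F := by
  refine contDiff_iff_contDiffAt.2 fun z => ?_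
  by_cases hz : z ∈ K
  · exact h z hz
  · refine (contDiffAt_const (c := (0 : ℝ))).congr_of_eventuallyEq ?_
    filter_upwards [hK.isOpen_compl.mem_nhds hz] with y hy using h0 y hy

lemma continuous_of_eq_zero_off {F : Heis n → ℝ} {K : Set (Heis n)} (hK : IsClosed K)
    (h0 : ∀ z, z ∉ K → F z = 0) (h : ∀ z ∈ K, ContinuousAt F z) : Continuous F := by
  refine continuous_iff_continuousAt.2 fun z => ?_
  by_cases hz : z ∈ K
  · exact h z hz
  · refine (continuousAt_const (y := (0 : ℝ))).congr ?_
    filter_upwards [hK.isOpen_compl.mem_nhds hz] with y hy using (h0 y hy).symm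

lemma continuous_regWeight_mul_gaugeDeriv {φ : Heis n → ℝ} (hφ : ContDiff ℝ 1 φ)
    (hs : (0 : Heis n) ∉ tsupport φ) (q k : ℝ) {ε : ℝ} (hε : 0 < ε) :
    Continuous fun z => regWeight q k ε z * gaugeDeriv φ z :=
  continuous_of_eq_zero_off (isClosed_tsupport φ)
    (fun z hz => by rw [gaugeDeriv_eq_zero hz, mul_zero])
    (fun z hz => (contDiffAt_regWeight q k hε (fun h => hs (h ▸ hz))).continuousAt.mul
      (continuous_gaugeDeriv hφ).continuousAt)

lemma integral_regWeight_mul_gaugeDeriv_nonneg {φ : Heis n → ℝ} (hφ : ContDiff ℝ 1 φ)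
    (hc : HasCompactSupport φ) (hs : (0 : Heis n) ∉ tsupport φ)
    (h0 : ∀ z, 0 ≤ φ z) {p k : ℝ} (hp : 1 < p)
    (hk : 2 * n + 4 + p ≤ 4 * k) {ε : ℝ} (hε : 0 < ε) :
    0 ≤ ∫ z, regWeight ((p - 2) / 2) k ε z * gaugeDeriv φ z := by
  set W := regWeight (n := n) ((p - 2) / 2) k ε with hW
  have hne : ∀ z ∈ tsupport φ, z ≠ 0 := fun z hz h => hs (h ▸ hz)
  have hφ0 : ∀ z, z ∉ tsupport φ → φ z = 0 := fun z hz => image_eq_zero_of_notMem_tsupport hz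
  have hWd : ∀ z ∈ tsupport φ, ContDiffAt ℝ 1 W z := fun z hz =>
    contDiffAt_regWeight _ k hε (hne z hz)
  have hprod : ∀ A : Heis n → ℝ, ContDiff ℝ 1 A →
      ContDiff ℝ 1 (fun z => A z * (W z * φ z)) ∧
      HasCompactSupport (fun z => A z * (W z * φ z)) ∧
      (∀ z v, fderiv ℝ (fun z => A z * (W z * φ z)) z v =
        A z * (W z * fderiv ℝ φ z v + φ z * fderiv ℝ W z v) + W z * φ z * fderiv ℝ A z v) := by
    intro A hA
    refine ⟨contDiff_of_eq_zero_off (isClosed_tsupport φ) (fun z hz => by simp [hφ0 z hz])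
      (fun z hz => hA.contDiffAt.mul ((hWd z hz).mul hφ.contDiffAt)), hc.mul_left.mul_left,
      fun z v => ?_⟩
    by_cases hz : z ∈ tsupport φ
    · have h1 : HasFDerivAt A _ z := (hA.differentiable (by simp) z).hasFDerivAt
      have h2 : HasFDerivAt W _ z := ((hWd z hz).differentiableAt (by simp)).hasFDerivAt
      have h3 : HasFDerivAt φ _ z := (hφ.differentiable (by simp) z).hasFDerivAt
      have h4 := (h1.mul (h2.mul h3)).fderiv
      have h5 : fderiv ℝ (fun z => A z * (W z * φ z)) z = _ := h4
      rw [h5]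
      simp
      ring
    · have e1 : φ =ᶠ[𝓝 z] fun _ => 0 := notMem_tsupport_iff_eventuallyEq.1 hz
      have e2 : (fun z => A z * (W z * φ z)) =ᶠ[𝓝 z] fun _ => 0 := by
        filter_upwards [e1] with y hy
        rw [hy]; ring
      rw [e2.fderiv_eq, e1.fderiv_eq, hφ0 z hz]
      simp
  obtain ⟨hZ1, hZ2, hZ3⟩ := hprod horSq contDiff_horSq
  have htd : ContDiff ℝ 1 fun z : Heis n => z (tIdx n) := by fun_prop
  obtain ⟨hR1, hR2, hR3⟩ := hprod (fun z => z (tIdx n)) htd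
  have IZ := integral_fderiv_linear hZ1 hZ2 (ZLin n)
  have IR := integral_fderiv_linear hR1 hR2 (rot n)
  rw [trace_ZLin] at IZ
  rw [trace_rot, neg_zero, zero_mul] at IR
  have iZ := hZ1.continuous.integrable_of_hasCompactSupport (μ := volume) hZ2
  have cdcs : ∀ (ψ : Heis n → ℝ) (B : Heis n →L[ℝ] Heis n), ContDiff ℝ 1 ψ →
      HasCompactSupport ψ → Integrable fun z => fderiv ℝ ψ z (B z) := fun ψ B h1 h2 => by
    refine ((h1.continuous_fderiv (by simp)).clm_apply
      B.continuous).integrable_of_hasCompactSupport ?_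
    refine (h2.fderiv (𝕜 := ℝ)).mono fun z hz => ?_
    intro h
    exact hz (by simp [h])
  have jZ := cdcs _ (ZLin n) hZ1 hZ2
  have jR := cdcs _ (rot n) hR1 hR2
  have total : ∫ z, (fderiv ℝ (fun z => horSq z * (W z * φ z)) z (ZLin n z) +
      (2 * n + 2) * (horSq z * (W z * φ z)) +
      fderiv ℝ (fun z => z (tIdx n) * (W z * φ z)) z (rot n z)) = 0 := by
    have j12 : Integrable fun z => fderiv ℝ (fun z => horSq z * (W z * φ z)) z (ZLin n z) +
      (2 * n + 2) * (horSq z * (W z * φ z)) := jZ.add (iZ.const_mul _)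
    rw [integral_add j12 jR, integral_add jZ (iZ.const_mul _), IZ, IR,
      integral_const_mul]
    ring
  rw [← total]
  refine integral_mono ((jZ.add (iZ.const_mul _)).add jR)
    ((continuous_regWeight_mul_gaugeDeriv hφ hs _ k hε).integrable_of_hasCompactSupport
      (HasCompactSupport.of_support_subset_isCompact hc fun z hz => ?_)) fun z => ?_
  · by_contra h
    exact hz (by simp [gaugeDeriv_eq_zero h])
  · simp only [hZ3, hR3, ZLin_apply]
    by_cases hz : z ∈ tsupport φ
    · have hN := gauge4_pos (hne z hz)
      have hr := horSq_nonneg z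
      have hWn : 0 ≤ W z := regWeight_nonneg _ k hε.le z
      have hd : fderiv ℝ (fun z : Heis n => z (tIdx n)) z (rot n z) = 0 := by
        have : fderiv ℝ (fun z : Heis n => z (tIdx n)) z = ContinuousLinearMap.proj (tIdx n) :=
          (hasFDerivAt_apply _ z).fderiv
        rw [this]
        simp
      rw [hd, hW, fderiv_regWeight _ k hε (hne z hz), fderiv_regWeight _ k hε (hne z hz), ← hW,
        fderiv_horSq_rot, fderiv_gauge4_rot, fderiv_horSq_Zvf, fderiv_gauge4_Zvf, gaugeDeriv]
      have e1 : k * (4 * gauge4 z) / gauge4 z = 4 * k := by field_simp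
      have e2 : (p - 2) / 2 * (2 * horSq z) / (horSq z + ε) =
          (p - 2) * (horSq z / (horSq z + ε)) := by ring
      have hq0 : 0 ≤ horSq z / (horSq z + ε) := by positivity
      have hq1 : horSq z / (horSq z + ε) ≤ 1 := by
        rw [div_le_one (by positivity)]; linarith
      have hq : (p - 2) * (horSq z / (horSq z + ε)) ≤ p := by nlinarith
      rw [e1, e2]
      have key : 0 ≤ horSq z * (W z * φ z) *
          (4 * k - (2 * n + 4) - (p - 2) * (horSq z / (horSq z + ε))) :=
        mul_nonneg (mul_nonneg hr (mul_nonneg hWn (h0 z))) (by linarith)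
      have : ∀ q : ℝ, 0 ≤ horSq z * (W z * φ z) * (4 * k - (2 * n + 4) - q) →
        horSq z * (W z * fderiv ℝ φ z (Zvf z) + φ z * (W z * (q - 4 * k))) +
          W z * φ z * (2 * horSq z) + (2 * n + 2) * (horSq z * (W z * φ z)) +
          (z (tIdx n) * (W z * fderiv ℝ φ z (rot n z) + φ z * (W z *
            ((p - 2) / 2 * 0 / (horSq z + ε) - k * 0 / gauge4 z))) + W z * φ z * 0) ≤
        W z * (horSq z * fderiv ℝ φ z (Zvf z) + z (tIdx n) * fderiv ℝ φ z (rot n z)) := by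
        intro q hq
        simp only [mul_zero, zero_div, sub_zero, add_zero]
        linarith
      exact this _ key
    · have e1 : φ =ᶠ[𝓝 z] fun _ => 0 := notMem_tsupport_iff_eventuallyEq.1 hz
      rw [gaugeDeriv_eq_zero hz, e1.fderiv_eq, hφ0 z hz]
      simp

lemma integral_weight_mul_gaugeDeriv_nonneg {φ : Heis n → ℝ} (hφ : ContDiff ℝ 1 φ)
    (hc : HasCompactSupport φ) (hs : (0 : Heis n) ∉ tsupport φ)
    (h0 : ∀ z, 0 ≤ φ z) {p k : ℝ} (hp : 1 < p)
    (hk : 2 * n + 4 + p ≤ 4 * k) :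
    0 ≤ ∫ z, regWeight ((p - 2) / 2) k 0 z * gaugeDeriv φ z := by
  have hne : ∀ z ∈ tsupport φ, z ≠ 0 := fun z hz h => hs (h ▸ hz)
  set ε : ℕ → ℝ := fun m => 1 / ((m : ℝ) + 1) with hε
  have hε0 : ∀ m, 0 < ε m := fun m => by positivity
  have hε1 : ∀ m, ε m ≤ 1 := fun m => by
    rw [hε]; simp only; rw [div_le_one (by positivity)]; linarith [Nat.cast_nonneg (α := ℝ) m]
  have hlim0 : Tendsto ε atTop (𝓝 0) := tendsto_one_div_add_atTop_nhds_zero_nat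
  set b : Heis n → ℝ := fun z =>
    (horSq z + 1) ^ ((p - 1) / 2) * gauge4 z ^ (-k) * √(gauge4 z) * ‖hgrad φ z‖ with hb
  have hbc : Continuous b := continuous_of_eq_zero_off (isClosed_tsupport φ)
    (fun z hz => by simp [hb, hgrad_eq_zero_of_notMem hz]) fun z hz => by
      have := horSq_nonneg z
      refine ((ContinuousAt.mul ?_ ?_).mul ?_).mul (continuousAt_hgrad hφ.contDiffAt).norm
      · exact (continuous_horSq.continuousAt.add continuousAt_const).rpow_const
          (Or.inl (by change horSq z + 1 ≠ 0; positivity))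
      · exact continuous_gauge4.continuousAt.rpow_const (Or.inl (gauge4_pos (hne z hz)).ne')
      · exact continuous_gauge4.sqrt.continuousAt
  have hbs : HasCompactSupport b := HasCompactSupport.of_support_subset_isCompact hc fun z hz => by
    by_contra h
    exact hz (by simp [hb, hgrad_eq_zero_of_notMem h])
  have hlim : Tendsto (fun m => ∫ z, regWeight ((p - 2) / 2) k (ε m) z * gaugeDeriv φ z) atTop
      (𝓝 (∫ z, regWeight ((p - 2) / 2) k 0 z * gaugeDeriv φ z)) := by
    refine tendsto_integral_filter_of_dominated_convergence b
      (Eventually.of_forall fun m =>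
        (continuous_regWeight_mul_gaugeDeriv hφ hs _ k (hε0 m)).aestronglyMeasurable)
      (Eventually.of_forall fun m => ae_of_all _ fun z => ?_)
      (hbc.integrable_of_hasCompactSupport hbs) (ae_of_all _ fun z => ?_)
    · have hr := horSq_nonneg z
      have hN := gauge4_nonneg z
      have hrε : 0 < horSq z + ε m := by have := hε0 m; positivity
      have h1 : (horSq z + ε m) ^ ((p - 2) / 2) * √(horSq z) ≤ (horSq z + 1) ^ ((p - 1) / 2) := by
        calc (horSq z + ε m) ^ ((p - 2) / 2) * √(horSq z)
            ≤ (horSq z + ε m) ^ ((p - 2) / 2) * √(horSq z + ε m) := by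
              gcongr; linarith [hε0 m]
          _ = (horSq z + ε m) ^ ((p - 1) / 2) := by
              rw [Real.sqrt_eq_rpow, ← Real.rpow_add hrε]; ring_nf
          _ ≤ _ := Real.rpow_le_rpow hrε.le (by linarith [hε1 m]) (by linarith)
      rw [norm_mul, Real.norm_eq_abs, Real.norm_eq_abs,
        abs_of_nonneg (regWeight_nonneg _ k (hε0 m).le z)]
      calc regWeight ((p - 2) / 2) k (ε m) z * |gaugeDeriv φ z|
          ≤ regWeight ((p - 2) / 2) k (ε m) z * (√(horSq z) * √(gauge4 z) * ‖hgrad φ z‖) :=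
            mul_le_mul_of_nonneg_left (abs_gaugeDeriv_le φ z) (regWeight_nonneg _ k (hε0 m).le z)
        _ = ((horSq z + ε m) ^ ((p - 2) / 2) * √(horSq z)) *
            (gauge4 z ^ (-k) * √(gauge4 z) * ‖hgrad φ z‖) := by unfold regWeight; ring
        _ ≤ (horSq z + 1) ^ ((p - 1) / 2) * (gauge4 z ^ (-k) * √(gauge4 z) * ‖hgrad φ z‖) := by
            gcongr
        _ = b z := by simp only [hb]; ring
    · by_cases hz : gaugeDeriv φ z = 0
      · simp [hz]
      have hr : horSq z ≠ 0 := fun h => hz <| abs_nonpos_iff.1 <| by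
        simpa [h] using abs_gaugeDeriv_le φ z
      refine Tendsto.mul_const _ (Tendsto.mul_const _ ?_)
      refine Tendsto.rpow_const (tendsto_const_nhds.add hlim0) (Or.inl ?_)
      rwa [add_zero]
  exact ge_of_tendsto' hlim fun m =>
    integral_regWeight_mul_gaugeDeriv_nonneg hφ hc hs h0 hp hk (hε0 m)

lemma hgrad_gauge4_rpow (α : ℝ) {z : Heis n} (hz : z ≠ 0) :
    hgrad (fun w => gauge4 w ^ (-α)) z = (-α * gauge4 z ^ (-α - 1)) • hgrad gauge4 z := by
  have h2 : HasFDerivAt gauge4 (fderiv ℝ gauge4 z) z :=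
    ((contDiff_gauge4 (m := 1)).differentiable (by simp) z).hasFDerivAt
  have h4 : HasFDerivAt (fun z => gauge4 z ^ (-α)) _ z :=
    h2.rpow_const (p := -α) (Or.inl (gauge4_pos hz).ne')
  ext k
  simp [hgrad_apply, h4.fderiv]

lemma energy_gauge4_rpow {p α : ℝ} (hα : 0 < α) (φ : Heis n → ℝ) {z : Heis n} (hz : z ≠ 0) :
    energy p (fun w => gauge4 w ^ (-α)) φ z = -(α ^ (p - 2) * 16 ^ ((p - 2) / 2) * α * 4) *
      (regWeight ((p - 2) / 2) ((α + 1) * (p - 1) - (p - 2) / 2) 0 z * gaugeDeriv φ z) := by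
  have hN := gauge4_pos hz
  have hr := horSq_nonneg z
  rw [energy, hgrad_gauge4_rpow α hz, inner_smul_left, inner_hgrad_gauge4, norm_smul,
    norm_hgrad_gauge4, Real.norm_eq_abs, abs_mul, abs_neg, abs_of_pos hα,
    abs_of_pos (Real.rpow_pos_of_pos hN _), Real.mul_rpow (by positivity) (by positivity),
    Real.mul_rpow (by positivity) (by positivity), Real.sqrt_eq_rpow,
    ← Real.rpow_mul (by positivity), ← Real.rpow_mul (by positivity),
    show 1 / 2 * (p - 2) = (p - 2) / 2 by ring, Real.mul_rpow (by positivity) (by positivity),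
    Real.mul_rpow (by positivity) (by positivity), regWeight, add_zero,
    show -((α + 1) * (p - 1) - (p - 2) / 2) =
      (-α - 1) * (p - 2) + (p - 2) / 2 + (-α - 1) by ring,
    Real.rpow_add hN, Real.rpow_add hN]
  simp only [conj_trivial]
  ring

/-- High negative powers of the gauge are weak subsolutions away from the origin. -/
lemma weakSub_gauge4_rpow {p α : ℝ} (hp : 1 < p) (hα : 0 < α)
    (hk : 2 * n + 4 + p ≤ 4 * ((α + 1) * (p - 1) - (p - 2) / 2)) :
    WeakSub (n := n) p (fun w => gauge4 w ^ (-α)) {0}ᶜ := by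
  intro φ hφ hc hs h0
  have hs0 : (0 : Heis n) ∉ tsupport φ := fun h => hs h rfl
  have h := integral_weight_mul_gaugeDeriv_nonneg hφ hc hs0 h0 hp hk
  have e : ∀ z, energy p (fun w => gauge4 w ^ (-α)) φ z =
      -(α ^ (p - 2) * 16 ^ ((p - 2) / 2) * α * 4) *
      (regWeight ((p - 2) / 2) ((α + 1) * (p - 1) - (p - 2) / 2) 0 z * gaugeDeriv φ z) := by
    intro z
    by_cases hz : z ∈ tsupport φ
    · exact energy_gauge4_rpow hα φ fun h => hs0 (h ▸ hz)
    · rw [energy_eq_zero_of_notMem hz, gaugeDeriv_eq_zero hz]; ring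
  simp only [e]
  rw [integral_const_mul, neg_mul]
  have : 0 < α ^ (p - 2) * 16 ^ ((p - 2) / 2) * α * 4 := by positivity
  exact neg_nonpos.2 (mul_nonneg this.le h)

lemma exists_weakSub_gauge4_rpow (n : ℕ) {p : ℝ} (hp : 1 < p) :
    ∃ α : ℝ, 1 ≤ α ∧ WeakSub (n := n) p (fun w => gauge4 w ^ (-α)) {0}ᶜ := by
  have hp' : 0 < p - 1 := by linarith
  have hq : 0 ≤ (2 * n + 4 + p) / (p - 1) := by positivity
  refine ⟨1 + (2 * n + 4 + p) / (p - 1), by linarith,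
    weakSub_gauge4_rpow hp (by linarith) ?_⟩
  have h : (2 * n + 4 + p) / (p - 1) * (p - 1) = 2 * n + 4 + p := by field_simp
  nlinarith [Nat.cast_nonneg (α := ℝ) n]

/-! ### The barrier on gauge balls -/

lemma rpow_neg_sub_ge {α x M : ℝ} (hα : 1 ≤ α) (hx : 0 < x) (hxM : x ≤ M) :
    M ^ (-α) * (M - x) / M ≤ x ^ (-α) - M ^ (-α) := by
  have hM : 0 < M := hx.trans_le hxM
  have h1 : M / x ≤ (M / x) ^ α :=
    Real.self_le_rpow_of_one_le ((one_le_div hx).2 hxM) hα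
  have h2 : (M / x) ^ α * M ^ (-α) = x ^ (-α) := by
    rw [Real.div_rpow hM.le hx.le, Real.rpow_neg hM.le, Real.rpow_neg hx.le]
    field_simp
  have hMα : 0 < M ^ (-α) := Real.rpow_pos_of_pos hM _
  have h3 : (M - x) / M ≤ M / x - 1 := by
    rw [div_sub_one hx.ne']
    gcongr
  rw [← h2, mul_div_assoc]
  nlinarith

lemma barrier (hn : 1 ≤ n) {p : ℝ} (hp : 1 < p) {δ M : ℝ} (hδ : 0 < δ) (hM : 0 < M) :
    ∃ c > 0, ∀ (v : Heis n → ℝ) (D : Set (Heis n)) (a : Heis n), Continuous v → (∀ z, 0 ≤ v z) →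
      IsOpen D → ContDiffOn ℝ 1 v D → WeakSub p (fun z => -v z) D →
      (∀ w, gauge4 (mul (inv a) w) ≤ M / 2 → δ ≤ v w) →
      (∀ w, gauge4 (mul (inv a) w) < M → w ∉ D → δ ≤ v w) →
      ∀ w, c * (M - gauge4 (mul (inv a) w)) ≤ v w := by
  obtain ⟨α, hα, hsub⟩ := exists_weakSub_gauge4_rpow n hp
  have hM2 : 0 < M / 2 := by positivity
  have hlt : M ^ (-α) < (M / 2) ^ (-α) :=
    Real.rpow_lt_rpow_of_neg hM2 (by linarith) (by linarith)
  have hMα : 0 < M ^ (-α) := Real.rpow_pos_of_pos hM _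
  set c₀ := δ / ((M / 2) ^ (-α) - M ^ (-α)) with hc₀
  have hc₀0 : 0 < c₀ := div_pos hδ (by linarith)
  have hc₀δ : c₀ * ((M / 2) ^ (-α) - M ^ (-α)) = δ := div_mul_cancel₀ _ (by linarith)
  refine ⟨min (δ / M) (c₀ * M ^ (-α) / M), by positivity,
    fun v D a hv hv0 hD hvD hsup hin hout w => ?_⟩
  set h : Heis n → ℝ := fun w => gauge4 (mul (inv a) w) with hh
  have hhc : Continuous h := continuous_gauge4.comp (continuous_const.heis_mul continuous_id)
  have hh0 : ∀ z, 0 ≤ h z := fun z => gauge4_nonneg _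
  have hδle : ∀ w, h w < M → δ ≤ v w → min (δ / M) (c₀ * M ^ (-α) / M) * (M - h w) ≤ v w := by
    intro w hwM hw
    calc min (δ / M) (c₀ * M ^ (-α) / M) * (M - h w) ≤ δ / M * (M - h w) :=
          mul_le_mul_of_nonneg_right (min_le_left _ _) (by linarith)
      _ ≤ δ / M * M := mul_le_mul_of_nonneg_left (by linarith [hh0 w]) (by positivity)
      _ = δ := by field_simp
      _ ≤ v w := hw
  rcases le_or_gt M (h w) with hwM | hwM
  · exact (mul_nonpos_of_nonneg_of_nonpos (by positivity) (by linarith)).trans (hv0 w)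
  rcases le_or_gt (h w) (M / 2) with hw2 | hw2
  · exact hδle w hwM (hin w hw2)
  by_cases hwD : w ∉ D
  · exact hδle w hwM (hout w hwM hwD)
  rw [not_not] at hwD
  set U := D ∩ {z | M / 2 < h z ∧ h z < M} with hU
  set f : Heis n → ℝ := fun z => c₀ * (h z ^ (-α) + -M ^ (-α)) with hf
  have hUo : IsOpen U := hD.inter ((isOpen_lt continuous_const hhc).inter
    (isOpen_lt hhc continuous_const))
  have hclU : closure U ⊆ {z | M / 2 ≤ h z ∧ h z ≤ M} :=
    closure_minimal (fun z hz => ⟨hz.2.1.le, hz.2.2.le⟩)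
      ((isClosed_le continuous_const hhc).inter (isClosed_le hhc continuous_const))
  have hcompact : IsCompact {z | h z ≤ M} := by
    have := (isCompact_gauge4_le (n := n) M).image
      (continuous_const.heis_mul continuous_id : Continuous fun z : Heis n => mul a z)
    refine this.of_isClosed_subset (isClosed_le hhc continuous_const) fun z hz => ?_
    exact ⟨mul (inv a) z, hz, mul_inv_cancel_left' a z⟩
  have hUb : Bornology.IsBounded U := hcompact.isBounded.subset fun z hz => hz.2.2.le
  have hC1 : ContDiffOn ℝ 1 (fun z : Heis n => gauge4 z ^ (-α)) {0}ᶜ := fun z hz =>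
    (contDiff_gauge4.contDiffAt.rpow_const_of_ne (gauge4_pos hz).ne').contDiffWithinAt
  have hne : U ⊆ (trans (inv a)).toHomeo ⁻¹' {0}ᶜ := fun z hz h0 => by
    have h0' : mul (inv a) z = 0 := by rw [← trans_apply]; exact h0
    have : h z = 0 := by simp only [hh, h0', gauge4_zero]
    linarith [hz.2.1]
  have hfsub : WeakSub p f U := by
    have h1 := ((trans (inv a)).weakSub_comp hsub isOpen_compl_singleton hC1).mono hne
    simp only [trans_apply] at h1
    exact (h1.add_const _).const_mul hc₀0.le
  have hf1 : ContDiffOn ℝ 1 f U := by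
    have h1 : ContDiffOn ℝ 1 (fun z => gauge4 ((trans (inv a)).toHomeo z) ^ (-α)) U :=
      hC1.comp (trans (inv a)).contDiff_toHomeo.contDiffOn hne
    simp only [trans_apply] at h1
    exact contDiffOn_const.mul (h1.add contDiffOn_const)
  have hfc : ContinuousOn f (closure U) := continuousOn_const.mul
    ((hhc.continuousOn.rpow_const fun z hz => Or.inl (by linarith [(hclU hz).1])).add
      continuousOn_const)
  have hanti : ∀ z, M / 2 ≤ h z → f z ≤ δ := fun z hz => by
    rw [← hc₀δ, sub_eq_add_neg]
    exact mul_le_mul_of_nonneg_left (add_le_add_left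
      (Real.rpow_le_rpow_of_nonpos hM2 hz (by linarith)) _) hc₀0.le
  have hcomp := comparison hn hp hUo hUb hfsub (hsup.mono inter_subset_left) hf1
    (hvD.mono inter_subset_left) hfc hv.continuousOn (fun z hz hzU => ?_) w ⟨hwD, hw2, hwM⟩
  · calc min (δ / M) (c₀ * M ^ (-α) / M) * (M - h w) ≤ c₀ * M ^ (-α) / M * (M - h w) :=
          mul_le_mul_of_nonneg_right (min_le_right _ _) (by linarith)
      _ = c₀ * (M ^ (-α) * (M - h w) / M) := by ring
      _ ≤ c₀ * (h w ^ (-α) - M ^ (-α)) := mul_le_mul_of_nonneg_left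
          (rpow_neg_sub_ge hα (by linarith) hwM.le) hc₀0.le
      _ ≤ v w := by rw [sub_eq_add_neg]; exact hcomp
  · obtain ⟨h1, h2⟩ := hclU hz
    rcases h1.lt_or_eq with h1' | h1'
    · rcases h2.lt_or_eq with h2' | h2'
      · exact (hanti z h1).trans (hout z h2' fun hzD => hzU ⟨hzD, h1', h2'⟩)
      · simp only [hf, h2']
        simpa using hv0 z
    · exact (hanti z h1).trans (hin z h1'.ge)

lemma hasFDerivAt_mul_left (a z : Heis n) :
    HasFDerivAt (mul a) ((trans a).lin : Heis n →L[ℝ] Heis n) z := by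
  have h : HasFDerivAt (fun z => (trans a).lin z + a) _ z :=
    (trans a).lin.hasFDerivAt.add_const a
  refine h.congr_of_eventuallyEq (Eventually.of_forall fun w => ?_)
  exact (trans_apply a w).symm

lemma hasDerivAt_mul_left (a : Heis n) {γ : ℝ → Heis n} {γ' : Heis n} {s : ℝ}
    (h : HasDerivAt γ γ' s) : HasDerivAt (fun s => mul a (γ s)) (mul a γ' - a) s :=
  (hasFDerivAt_mul_left a (γ s)).comp_hasDerivAt s h

lemma differentiable_gauge4 : Differentiable ℝ (gauge4 : Heis n → ℝ) :=
  (contDiff_gauge4 (m := 1)).differentiable (by simp)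

lemma isCompact_gauge4_mul_le (a : Heis n) (M : ℝ) :
    IsCompact {z | gauge4 (mul (inv a) z) ≤ M} := by
  have hc : Continuous fun z => gauge4 (mul (inv a) z) :=
    continuous_gauge4.comp (continuous_const.heis_mul continuous_id)
  have := (isCompact_gauge4_le (n := n) M).image
    (continuous_const.heis_mul continuous_id : Continuous fun z : Heis n => mul a z)
  refine this.of_isClosed_subset (isClosed_le hc continuous_const) fun z hz => ?_
  exact ⟨mul (inv a) z, hz, mul_inv_cancel_left' a z⟩

/-! ### Supersolutions vanishing on an obstacle -/

/-- A nonnegative supersolution `v` on `D` vanishing on a closed set `K` which is strictly monotone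
under the dilations `dil (σ * s)` and touched at its boundary points by gauge balls of size `M`. -/
structure IsBarrierPair (p σ M : ℝ) (K D : Set (Heis n)) (v : Heis n → ℝ) : Prop where
  isClosed : IsClosed K
  isCompact_frontier : IsCompact (frontier K)
  dil_mem : ∀ z ∈ K, ∀ s > 0, dil (-(σ * s)) z ∈ interior K
  continuous : Continuous v
  nonneg : ∀ z, 0 ≤ v z
  eq_zero : ∀ z ∈ K, v z = 0
  one_le : ∀ z, z ∉ K → z ∉ D → 1 ≤ v z
  isOpen : IsOpen D
  isBounded : Bornology.IsBounded D
  contDiffOn : ContDiffOn ℝ 1 v D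
  weakSub : WeakSub p (fun z => -v z) D
  pos : 0 < M
  ball : ∀ z ∈ frontier K, ∃ a, gauge4 (mul (inv a) z) = M ∧ ∀ w ∈ K, M ≤ gauge4 (mul (inv a) w)
  absorb : ∃ s ≥ 0, ∀ w, v w = 0 → dil (-(σ * s)) w ∈ K
  defining : ∀ z ∈ frontier K, ∃ g : Heis n → ℝ, DifferentiableAt ℝ g z ∧ g z = 0 ∧
    0 < fderiv ℝ g z (σ • Zvf z) ∧ ∀ᶠ w in 𝓝 z, g w < 0 → w ∈ K

namespace IsBarrierPair

variable {p σ M : ℝ} {K D : Set (Heis n)} {v : Heis n → ℝ}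

/-- No interior zero of `v` lies on the boundary of a dilate of `K` that contains all zeros. -/
lemma notMem_frontier (hn : 1 ≤ n) (hp : 1 < p) (h : IsBarrierPair p σ M K D v) {s : ℝ}
    (hs : ∀ w, v w = 0 → dil (-(σ * s)) w ∈ K) {w : Heis n} (hwD : w ∈ D) (hw : v w = 0) :
    dil (-(σ * s)) w ∉ frontier K := by
  intro hfr
  obtain ⟨a₁, ha₁, hball⟩ := h.ball _ hfr
  set a := dil (σ * s) a₁ with ha
  set M' := Real.exp (4 * (σ * s)) * M with hM'
  have hM'0 : 0 < M' := mul_pos (Real.exp_pos _) h.pos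
  have hN : ∀ x, gauge4 (mul (inv a) x) =
      Real.exp (4 * (σ * s)) * gauge4 (mul (inv a₁) (dil (-(σ * s)) x)) := fun x => by
    rw [← gauge4_dil, dil_mul, dil_inv, dil_dil_neg]
  have hpos : ∀ x, gauge4 (mul (inv a) x) < M' → 0 < v x := fun x hx => by
    refine (h.nonneg x).lt_of_ne' fun h0 => ?_
    have h1 := hball _ (hs x h0)
    rw [hN] at hx
    have := lt_of_mul_lt_mul_left hx (Real.exp_pos _).le
    linarith
  obtain ⟨δ, hδ, hδv⟩ := (isCompact_gauge4_mul_le a (M' / 2)).exists_forall_le' (a := 0)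
    h.continuous.continuousOn fun x hx => hpos x (lt_of_le_of_lt hx (by linarith))
  obtain ⟨c, hc, hbar⟩ := barrier hn hp (lt_min hδ one_pos) hM'0
  have hv := hbar v D a h.continuous h.nonneg h.isOpen h.contDiffOn h.weakSub
    (fun x hx => (min_le_left _ _).trans (hδv x hx))
    (fun x hx hxD => (min_le_right _ _).trans
      (h.one_le x (fun hxK => (hpos x hx).ne' (h.eq_zero x hxK)) hxD))
  have hwM : gauge4 (mul (inv a) w) = M' := by rw [hN, ha₁]
  set γ : ℝ → Heis n := fun s => mul a (dil s (mul (inv a) w)) with hγ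
  have hγ0 : γ 0 = w := by simp only [hγ, dil_zero_left, mul_inv_cancel_left']
  have hγd : HasDerivAt γ _ 0 := hasDerivAt_mul_left a (hasDerivAt_dil (mul (inv a) w) 0)
  have hNγ : ∀ s, gauge4 (mul (inv a) (γ s)) = Real.exp (4 * s) * M' := fun s => by
    simp only [hγ, inv_mul_cancel_left', gauge4_dil, hwM]
  have hvd : HasFDerivAt v (fderiv ℝ v w) w :=
    ((h.contDiffOn.contDiffAt (h.isOpen.mem_nhds hwD)).differentiableAt (by simp)).hasFDerivAt
  have hvmin : IsLocalMin v w := Eventually.of_forall fun x => by rw [hw]; exact h.nonneg x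
  rw [hvmin.fderiv_eq_zero, ← hγ0] at hvd
  have h1 : HasDerivAt (fun s => v (γ s)) 0 0 := (hvd.comp_hasDerivAt 0 hγd).congr_deriv (by simp)
  have h2 : HasDerivAt (fun s : ℝ => Real.exp (4 * s) * M') (4 * M') 0 := by
    have := (((hasDerivAt_id (0 : ℝ)).const_mul 4).exp).mul_const M'
    simpa using this
  have h3 := h1.add ((h2.const_mul c))
  have hmin : IsLocalMin ((fun s => v (γ s)) + fun s => c * (Real.exp (4 * s) * M')) 0 :=
    Eventually.of_forall fun s => by
      have := hv (γ s)
      rw [hNγ] at this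
      simp only [Pi.add_apply, hγ0, hw, mul_zero, Real.exp_zero]
      linarith
  have h4 := hmin.hasDerivAt_eq_zero h3
  nlinarith [mul_pos hc hM'0]

/-- The zero set of `v` is exactly `K`. -/
lemma pos_of_notMem (hn : 1 ≤ n) (hp : 1 < p) (h : IsBarrierPair p σ M K D v) {z : Heis n}
    (hz : z ∉ K) : 0 < v z := by
  set S : Set ℝ := {s | 0 ≤ s ∧ ∀ w, v w = 0 → dil (-(σ * s)) w ∈ K} with hS
  have hSne : S.Nonempty := h.absorb
  have hSbd : BddBelow S := ⟨0, fun s hs => hs.1⟩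
  have hScl : IsClosed S := by
    have : S = Ici 0 ∩ ⋂ w, ⋂ (_ : v w = 0), (fun s => dil (-(σ * s)) w) ⁻¹' K := by
      ext s; simp [hS]
    rw [this]
    refine isClosed_Ici.inter (isClosed_iInter fun w => isClosed_iInter fun _ => ?_)
    exact h.isClosed.preimage (by fun_prop)
  set s₀ := sInf S with hs₀
  have hs₀S : s₀ ∈ S := hScl.csInf_mem hSne hSbd
  have hs₀0 : s₀ = 0 := by
    by_contra hne
    have hpos : 0 < s₀ := hs₀S.1.lt_of_ne' hne
    set t : ℕ → ℝ := fun m => s₀ - s₀ / ((m : ℝ) + 1) with ht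
    have htlim : Tendsto t atTop (𝓝 s₀) := by
      have h1 : Tendsto (fun m : ℕ => s₀ * (1 / ((m : ℝ) + 1))) atTop (𝓝 (s₀ * 0)) :=
        tendsto_one_div_add_atTop_nhds_zero_nat.const_mul s₀
      have h2 := tendsto_const_nhds (x := s₀) |>.sub h1
      simpa [ht, div_eq_mul_inv] using h2
    have ht0 : ∀ m, 0 ≤ t m := fun m => by
      have : s₀ / ((m : ℝ) + 1) ≤ s₀ :=
        div_le_self hpos.le (by linarith [Nat.cast_nonneg (α := ℝ) m])
      simp only [ht]; linarith
    have htlt : ∀ m, t m < s₀ := fun m => by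
      have : 0 < s₀ / ((m : ℝ) + 1) := by positivity
      simp only [ht]; linarith
    have hex : ∀ m, ∃ w, v w = 0 ∧ dil (-(σ * t m)) w ∉ K := fun m => by
      by_contra! hcon
      exact absurd (csInf_le hSbd ⟨ht0 m, hcon⟩) (not_le.2 (htlt m))
    choose w hw0 hwK using hex
    have hwnK : ∀ m, w m ∉ K := fun m hm => by
      rcases (ht0 m).eq_or_lt with h0 | h0
      · apply hwK m
        rw [← h0]
        simpa [dil_zero_left] using hm
      · exact hwK m (interior_subset (h.dil_mem _ hm _ h0))
    have hwD : ∀ m, w m ∈ D := fun m => by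
      by_contra hD
      have := h.one_le _ (hwnK m) hD
      rw [hw0] at this
      linarith
    obtain ⟨x, -, θ, hθ, hlim⟩ := tendsto_subseq_of_bounded h.isBounded hwD
    have hx0 : v x = 0 := by
      have := (h.continuous.tendsto x).comp hlim
      refine tendsto_nhds_unique this ?_
      simp [Function.comp_def, hw0]
    have hxfr : dil (-(σ * s₀)) x ∈ frontier K := by
      rw [h.isClosed.frontier_eq]
      refine ⟨hs₀S.2 x hx0, ?_⟩
      have hcont : Continuous fun q : ℝ × Heis n => dil (-(σ * q.1)) q.2 := by fun_prop
      have hl := (hcont.tendsto (s₀, x)).comp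
        ((htlim.comp hθ.tendsto_atTop).prodMk_nhds hlim)
      intro hint
      obtain ⟨m, hm⟩ := (hl.eventually (isOpen_interior.mem_nhds hint)).exists
      exact hwK _ (interior_subset hm)
    have hxD : x ∈ D := by
      by_contra hD
      by_cases hxK : x ∈ K
      · have := h.dil_mem x hxK s₀ hpos
        rw [h.isClosed.frontier_eq] at hxfr
        exact hxfr.2 this
      · have := h.one_le _ hxK hD
        rw [hx0] at this
        linarith
    exact h.notMem_frontier hn hp hs₀S.2 hxD hx0 hxfr
  refine (h.nonneg z).lt_of_ne' fun h0 => hz ?_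
  have := hs₀S.2 z h0
  simpa [hs₀0, dil_zero_left] using this

/-- The gauge of a touching ball decreases strictly along the dilation flow. -/
lemma fderiv_gauge_neg (h : IsBarrierPair p σ M K D v) {z a : Heis n} (hz : z ∈ frontier K)
    (ha : gauge4 (mul (inv a) z) = M) (hK : ∀ w ∈ K, M ≤ gauge4 (mul (inv a) w)) :
    fderiv ℝ (fun w => gauge4 (mul (inv a) w)) z (σ • Zvf z) < 0 := by
  obtain ⟨g, hg, hg0, hgZ, hgK⟩ := h.defining z hz
  set N : Heis n → ℝ := fun w => gauge4 (mul (inv a) w) with hN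
  have hNd : HasFDerivAt N (fderiv ℝ N z) z :=
    ((differentiable_gauge4 _).comp z
      (hasFDerivAt_mul_left (inv a) z).differentiableAt).hasFDerivAt
  obtain ⟨η, hη⟩ : ∃ η, fderiv ℝ N z η = 4 * M := by
    set γ : ℝ → Heis n := fun s => mul a (dil s (mul (inv a) z)) with hγ
    have hγ0 : γ 0 = z := by simp only [hγ, dil_zero_left, mul_inv_cancel_left']
    have hγd : HasDerivAt γ _ 0 := hasDerivAt_mul_left a (hasDerivAt_dil (mul (inv a) z) 0)
    refine ⟨mul a (Zvf (dil 0 (mul (inv a) z))) - a, ?_⟩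
    have h1 := (hγ0.symm ▸ hNd : HasFDerivAt N (fderiv ℝ N z) (γ 0)).comp_hasDerivAt 0 hγd
    have h2 : HasDerivAt (fun s : ℝ => Real.exp (4 * s) * M) (4 * M) 0 := by
      have := (((hasDerivAt_id (0 : ℝ)).const_mul 4).exp).mul_const M
      simpa using this
    have h3 : N ∘ γ = fun s : ℝ => Real.exp (4 * s) * M := by
      funext s
      simp only [hN, hγ, Function.comp, inv_mul_cancel_left', gauge4_dil, ha]
    rw [h3] at h1
    exact h1.unique h2
  set dg := fderiv ℝ g z with hdg
  set ε := dg (σ • Zvf z) / (2 * (|dg η| + 1)) with hε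
  have hε0 : 0 < ε := by positivity
  have hεb : ε * |dg η| < dg (σ • Zvf z) := by
    rw [hε, div_mul_eq_mul_div, div_lt_iff₀ (by positivity)]
    nlinarith [abs_nonneg (dg η)]
  set e := -(σ • Zvf z) - ε • η with he
  have hge : dg e < 0 := by
    have h1 : dg e = -dg (σ • Zvf z) - ε * dg η := by simp [he]
    have h2 : -(ε * dg η) ≤ ε * |dg η| := by
      rw [← mul_neg]; exact mul_le_mul_of_nonneg_left (neg_le_abs _) hε0.le
    rw [h1]
    linarith
  set ℓ : ℝ → Heis n := fun t => z + t • e with hℓ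
  have hℓ0 : ℓ 0 = z := by simp [hℓ]
  have hℓd : HasDerivAt ℓ e 0 := by
    have : HasDerivAt ℓ ((1 : ℝ) • e) 0 := ((hasDerivAt_id (0 : ℝ)).smul_const e).const_add z
    rwa [one_smul] at this
  have hgd : HasDerivAt (fun t => g (ℓ t)) (dg e) 0 :=
    (hℓ0.symm ▸ hg.hasFDerivAt : HasFDerivAt g dg (ℓ 0)).comp_hasDerivAt 0 hℓd
  have hNℓ : HasDerivAt (fun t => N (ℓ t)) (fderiv ℝ N z e) 0 :=
    (hℓ0.symm ▸ hNd : HasFDerivAt N (fderiv ℝ N z) (ℓ 0)).comp_hasDerivAt 0 hℓd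
  have hgneg : ∀ᶠ t in 𝓝[>] (0 : ℝ), g (ℓ t) < 0 := by
    have h1 : Tendsto (slope (fun t => g (ℓ t)) 0) (𝓝[>] 0) (𝓝 (dg e)) :=
      (hasDerivAt_iff_tendsto_slope.1 hgd).mono_left
        (nhdsWithin_mono 0 fun t (ht : 0 < t) => ht.ne')
    filter_upwards [h1.eventually (gt_mem_nhds hge), self_mem_nhdsWithin] with t h2 ht
    rw [slope_def_field, hℓ0, hg0, sub_zero, sub_zero] at h2
    exact (div_neg_iff.1 h2).elim (fun h => absurd h.2 (not_lt.2 (le_of_lt ht))) (·.1)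
  have hℓK : ∀ᶠ t in 𝓝[>] (0 : ℝ), ℓ t ∈ K := by
    have h1 : Tendsto ℓ (𝓝[>] 0) (𝓝 z) := by
      have := hℓd.continuousAt.tendsto
      rw [hℓ0] at this
      exact this.mono_left nhdsWithin_le_nhds
    filter_upwards [hgneg, h1.eventually hgK] with t h2 h3 using h3 h2
  have hNe : 0 ≤ fderiv ℝ N z e := by
    have h1 : Tendsto (slope (fun t => N (ℓ t)) 0) (𝓝[>] 0) (𝓝 (fderiv ℝ N z e)) :=
      (hasDerivAt_iff_tendsto_slope.1 hNℓ).mono_left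
        (nhdsWithin_mono 0 fun t (ht : 0 < t) => ht.ne')
    refine ge_of_tendsto h1 ?_
    filter_upwards [hℓK, self_mem_nhdsWithin] with t h2 ht
    rw [slope_def_field, hℓ0]
    have h3 : M ≤ N (ℓ t) := hK _ h2
    have h4 : N z = M := ha
    exact div_nonneg (by linarith) (by simpa using le_of_lt ht)
  have : fderiv ℝ N z e = -fderiv ℝ N z (σ • Zvf z) - ε * (4 * M) := by simp [he, hη]
  have := mul_pos hε0 (mul_pos four_pos h.pos)
  linarith

/-- Uniform linear growth of `v` along the dilation flow off `K`. -/
lemma exists_linear_growth (hn : 1 ≤ n) (hp : 1 < p) (h : IsBarrierPair p σ M K D v) :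
    ∃ c > 0, ∃ s₀ > 0, ∀ z ∈ frontier K, ∀ s ∈ Icc 0 s₀, c * s ≤ v (dil (σ * s) z) := by
  set S : Set (Heis n × Heis n) := {q | q.1 ∈ frontier K ∧ gauge4 q.2 = M ∧
    ∀ w ∈ K, M ≤ gauge4 (mul (mul q.2 (inv q.1)) w)} with hS
  have hScpt : IsCompact S := by
    refine (h.isCompact_frontier.prod (isCompact_gauge4_le (n := n) M)).of_isClosed_subset ?_
      fun q hq => ⟨hq.1, hq.2.1.le⟩
    have : S = (Prod.fst ⁻¹' frontier K) ∩ ({q | gauge4 q.2 = M} ∩ ⋂ w, ⋂ (_ : w ∈ K),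
        {q : Heis n × Heis n | M ≤ gauge4 (mul (mul q.2 (inv q.1)) w)}) := by
      ext q; simp [hS]
    rw [this]
    refine (isClosed_frontier.preimage continuous_fst).inter
      ((isClosed_eq (continuous_gauge4.comp continuous_snd) continuous_const).inter
        (isClosed_iInter fun w => isClosed_iInter fun _ => ?_))
    exact isClosed_le continuous_const (continuous_gauge4.comp (by fun_prop))
  have hinv : ∀ q : Heis n × Heis n, inv (mul q.1 (inv q.2)) = mul q.2 (inv q.1) := fun q => by
    rw [inv_mul_rev, inv_inv']
  have hout : ∀ q ∈ S, ∀ x, gauge4 (mul (inv (mul q.1 (inv q.2))) x) < M → x ∉ K :=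
    fun q hq x hx hxK => by
      rw [hinv] at hx
      exact absurd (hq.2.2 x hxK) (not_le.2 hx)
  obtain ⟨δ, hδ, hδv⟩ := (hScpt.prod (isCompact_gauge4_le (n := n) (M / 2))).exists_forall_le'
    (a := 0) (f := fun r => v (mul (mul r.1.1 (inv r.1.2)) r.2))
    (h.continuous.comp (by fun_prop)).continuousOn (fun r hr => by
      refine h.pos_of_notMem hn hp (hout r.1 hr.1 _ ?_)
      rw [inv_mul_cancel_left']
      have h1 : gauge4 r.2 ≤ M / 2 := hr.2
      linarith [h.pos])
  obtain ⟨c, hc, hbar⟩ := barrier hn hp (lt_min hδ one_pos) h.pos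
  have hv : ∀ q ∈ S, ∀ x, c * (M - gauge4 (mul (mul q.2 (inv q.1)) x)) ≤ v x := by
    intro q hq x
    rw [← hinv]
    refine hbar v D _ h.continuous h.nonneg h.isOpen h.contDiffOn h.weakSub (fun x hx => ?_)
      (fun x hx hxD => (min_le_right _ _).trans (h.one_le x (hout q hq x hx) hxD)) x
    have := hδv (q, mul (inv (mul q.1 (inv q.2))) x) ⟨hq, hx⟩
    simp only [mul_inv_cancel_left'] at this
    exact (min_le_left _ _).trans this
  set b : Heis n × Heis n → Heis n := fun q => mul q.2 (inv q.1) with hb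
  set G : Heis n × Heis n → ℝ → ℝ := fun q s => gauge4 (mul (b q) (dil (σ * s) q.1)) with hG
  set H : ℝ → Heis n × Heis n → ℝ := fun s q =>
    fderiv ℝ gauge4 (mul (b q) (dil (σ * s) q.1))
      (mul (b q) (σ • Zvf (dil (σ * s) q.1)) - b q) with hH
  have hGd : ∀ q s, HasDerivAt (G q) (H s q) s := by
    intro q s
    have h1 : HasDerivAt (fun s => dil (σ * s) q.1) (σ • Zvf (dil (σ * s) q.1)) s := by
      have := (hasDerivAt_dil q.1 (σ * s)).scomp s ((hasDerivAt_id s).const_mul σ)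
      simpa [Function.comp_def] using this
    exact (differentiable_gauge4 _).hasFDerivAt.comp_hasDerivAt s (hasDerivAt_mul_left (b q) h1)
  have hHc : Continuous fun r : ℝ × (Heis n × Heis n) => H r.1 r.2 := by
    have hb' : Continuous fun r : ℝ × (Heis n × Heis n) => b r.2 := by
      simp only [hb]; fun_prop
    have hz' : Continuous fun r : ℝ × (Heis n × Heis n) => dil (σ * r.1) r.2.1 := by fun_prop
    exact (((contDiff_gauge4 (m := 1)).continuous_fderiv (by simp)).comp
      (hb'.heis_mul hz')).clm_apply ((hb'.heis_mul (hz'.heis_Zvf.const_smul σ)).sub hb')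
  have hHneg : ∀ q ∈ S, H 0 q < 0 := by
    intro q hq
    have h1 : mul (inv (mul q.1 (inv q.2))) q.1 = q.2 := by
      rw [hinv, mul_assoc', inv_mul_self, mul_zero']
    have h2 := h.fderiv_gauge_neg (a := mul q.1 (inv q.2)) hq.1 (by rw [h1]; exact hq.2.1)
      (fun w hw => by rw [hinv]; exact hq.2.2 w hw)
    have h3 : HasFDerivAt (fun w => gauge4 (mul (b q) w)) _ q.1 :=
      (differentiable_gauge4 _).hasFDerivAt.comp q.1 (hasFDerivAt_mul_left (b q) q.1)
    rw [hinv, h3.fderiv] at h2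
    simp only [hH, mul_zero, dil_zero_left]
    exact h2
  obtain ⟨κ, hκ, hκH⟩ := hScpt.exists_forall_le' (a := 0) (f := fun q => -H 0 q)
    (hHc.comp (continuous_const.prodMk continuous_id)).neg.continuousOn
    (fun q hq => neg_pos.2 (hHneg q hq))
  have hev : ∀ᶠ s in 𝓝 (0 : ℝ), ∀ q ∈ S, H s q < -(κ / 2) := by
    refine hScpt.eventually_forall_of_forall_eventually fun q hq => ?_
    refine hHc.continuousAt.eventually (gt_mem_nhds ?_)
    have := hκH q hq
    change H 0 q < _
    linarith
  obtain ⟨r, hr, hrH⟩ := Metric.eventually_nhds_iff.1 hev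
  refine ⟨c * (κ / 2), by positivity, r / 2, by positivity, fun z hz s hs => ?_⟩
  obtain ⟨a, ha, haK⟩ := h.ball z hz
  have hbq : b (z, mul (inv a) z) = inv a := by
    simp only [hb, mul_assoc', mul_inv_self, mul_zero']
  have hqS : (z, mul (inv a) z) ∈ S := ⟨hz, ha, fun w hw => by
    rw [show mul (mul (inv a) z) (inv z) = inv a from hbq]; exact haK w hw⟩
  set q := (z, mul (inv a) z) with hq
  have h0 : G q 0 = M := by
    simp only [hG, hbq, mul_zero, dil_zero_left]
    exact ha
  have hmv := (convex_Icc 0 (r / 2)).image_sub_le_mul_sub_of_deriv_le (f := G q) (C := -(κ / 2))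
    (fun x _ => (hGd q x).continuousAt.continuousWithinAt)
    (fun x _ => (hGd q x).differentiableAt.differentiableWithinAt)
    (fun x hx => by
      rw [(hGd q x).deriv]
      rw [interior_Icc] at hx
      refine (hrH ?_ q hqS).le
      rw [Real.dist_eq, sub_zero, abs_of_pos hx.1]
      linarith [hx.2]) 0 ⟨le_rfl, by positivity⟩ s hs hs.1
  have := hv q hqS (dil (σ * s) z)
  change c * (M - G q s) ≤ _ at this
  rw [h0] at hmv
  calc c * (κ / 2) * s = c * (κ / 2 * s) := by ring
    _ ≤ c * (M - G q s) := mul_le_mul_of_nonneg_left (by linarith) hc.le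
    _ ≤ _ := this

end IsBarrierPair

/-! ### Strictly starshaped sets -/

lemma einner_grad (g : Heis n → ℝ) (z v : Heis n) : einner (grad g z) v = fderiv ℝ g z v := by
  conv_rhs => rw [pi_eq_sum_univ' v, map_sum]
  exact Finset.sum_congr rfl fun k _ => by rw [map_smul, smul_eq_mul, grad, mul_comm]

lemma grad_ne_zero {g : Heis n → ℝ} {z v : Heis n} (h : fderiv ℝ g z v ≠ 0) : grad g z ≠ 0 := by
  intro h0
  rw [← einner_grad, h0] at h
  simp [einner] at h

lemma norm_dil_neg_le {s : ℝ} (hs : 0 ≤ s) (z : Heis n) :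
    ‖dil (-s) z‖ ≤ Real.exp (-s) * ‖z‖ := by
  refine (pi_norm_le_iff_of_nonneg (by positivity)).2 fun k => ?_
  have hk := norm_le_pi_norm z k
  unfold dil
  split_ifs
  · rw [norm_mul, Real.norm_of_nonneg (Real.exp_pos _).le]
    exact mul_le_mul (Real.exp_le_exp.2 (by linarith)) hk (norm_nonneg _) (Real.exp_pos _).le
  · rw [norm_mul, Real.norm_of_nonneg (Real.exp_pos _).le]
    exact mul_le_mul_of_nonneg_left hk (Real.exp_pos _).le

lemma exists_dil_mem {B U : Set (Heis n)} (hB : Bornology.IsBounded B) (hU : IsOpen U)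
    (h0 : (0 : Heis n) ∈ U) : ∃ s ≥ 0, ∀ w ∈ B, dil (-s) w ∈ U := by
  obtain ⟨r, hr, hrU⟩ := Metric.isOpen_iff.1 hU 0 h0
  obtain ⟨R, hR, hRB⟩ := hB.exists_pos_norm_le
  have hlim : Tendsto (fun s : ℝ => Real.exp (-s) * R) atTop (𝓝 (0 * R)) :=
    (Real.tendsto_exp_neg_atTop_nhds_zero).mul_const R
  rw [zero_mul] at hlim
  obtain ⟨s, hs, hs0⟩ := ((hlim.eventually (gt_mem_nhds hr)).and (eventually_ge_atTop 0)).exists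
  refine ⟨s, hs0, fun w hw => hrU ?_⟩
  rw [mem_ball_zero_iff]
  calc ‖dil (-s) w‖ ≤ Real.exp (-s) * ‖w‖ := norm_dil_neg_le hs0 w
    _ ≤ Real.exp (-s) * R := mul_le_mul_of_nonneg_left (hRB w hw) (Real.exp_pos _).le
    _ < r := hs

lemma continuous_dil_left (z : Heis n) : Continuous fun s : ℝ => dil s z := by fun_prop

lemma hasDerivAt_comp_dil {g : Heis n → ℝ} {z : Heis n} (hg : DifferentiableAt ℝ g z) :
    HasDerivAt (fun s => g (dil s z)) (fderiv ℝ g z (Zvf z)) 0 := by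
  have h1 : HasFDerivAt g (fderiv ℝ g z) (dil 0 z) := by
    rw [dil_zero_left]; exact hg.hasFDerivAt
  have h2 := h1.comp_hasDerivAt 0 (hasDerivAt_dil z 0)
  rwa [dil_zero_left] at h2

namespace StrictStarshaped

variable {Ω : Set (Heis n)} {ν : Heis n → Heis n}

lemma exists_defining (h : StrictStarshaped Ω ν) {z : Heis n} (hz : z ∈ frontier Ω) :
    ∃ g : Heis n → ℝ, ContDiff ℝ 1 g ∧ g z = 0 ∧ 0 < fderiv ℝ g z (Zvf z) ∧
      ∀ᶠ w in 𝓝 z, (w ∈ interior Ω ↔ g w < 0) ∧ (w ∈ frontier Ω ↔ g w = 0) := by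
  obtain ⟨V, g, hV, hzV, hg, hint, hfr, hν⟩ := h.2.1 z hz
  refine ⟨g, hg, (hfr z hzV).1 hz, ?_, ?_⟩
  · have h1 := h.2.2 z hz
    rw [(hν z hzV hz).2] at h1
    have h2 : einner ((euclNorm (grad g z))⁻¹ • grad g z) (Zvf z) =
        (euclNorm (grad g z))⁻¹ * fderiv ℝ g z (Zvf z) := by
      rw [← einner_grad, einner, einner, Finset.mul_sum]
      exact Finset.sum_congr rfl fun k _ => by simp [mul_assoc]
    rw [h2] at h1
    exact pos_of_mul_pos_right h1 (inv_nonneg.2 (Real.sqrt_nonneg _))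
  · filter_upwards [hV.mem_nhds hzV] with w hw using ⟨hint w hw, hfr w hw⟩

lemma eventually_dil (h : StrictStarshaped Ω ν) {z : Heis n} (hz : z ∈ frontier Ω) :
    (∀ᶠ s in 𝓝[>] (0 : ℝ), dil s z ∉ closure Ω) ∧ ∀ᶠ s in 𝓝[<] (0 : ℝ), dil s z ∈ Ω := by
  obtain ⟨g, hg, hg0, hgZ, hloc⟩ := h.exists_defining hz
  have hd := hasDerivAt_comp_dil (hg.differentiable (by simp) z)
  have hs := hasDerivAt_iff_tendsto_slope.1 hd
  have hz0 : Tendsto (fun s => dil s z) (𝓝 0) (𝓝 z) := by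
    simpa [dil_zero_left] using (continuous_dil_left z).tendsto 0
  have hev := hs.eventually (lt_mem_nhds hgZ)
  have hloc' := hz0.eventually hloc
  constructor
  · have hmono : 𝓝[>] (0 : ℝ) ≤ 𝓝[≠] 0 := nhdsWithin_mono 0 fun t (ht : 0 < t) => ht.ne'
    filter_upwards [hmono hev, nhdsWithin_le_nhds hloc', self_mem_nhdsWithin] with s h1 h2 h3 h4
    rw [slope_def_field, dil_zero_left, hg0, sub_zero, sub_zero] at h1
    have h3' : 0 < s := h3
    have hpos : 0 < g (dil s z) := by
      have := mul_pos h1 h3'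
      rwa [div_mul_cancel₀ _ h3'.ne'] at this
    by_cases hi : dil s z ∈ interior Ω
    · have := h2.1.1 hi
      linarith
    · have := h2.2.1 ⟨h4, hi⟩
      linarith
  · have hmono : 𝓝[<] (0 : ℝ) ≤ 𝓝[≠] 0 := nhdsWithin_mono 0 fun t (ht : t < 0) => ht.ne
    filter_upwards [hmono hev, nhdsWithin_le_nhds hloc', self_mem_nhdsWithin] with s h1 h2 h3
    rw [slope_def_field, dil_zero_left, hg0, sub_zero, sub_zero] at h1
    have h3' : s < 0 := h3
    have hneg : g (dil s z) < 0 := by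
      have := mul_neg_of_pos_of_neg h1 h3'
      rwa [div_mul_cancel₀ _ h3'.ne] at this
    exact interior_subset (h2.1.2 hneg)

lemma dil_notMem_closure (h : StrictStarshaped Ω ν) (hΩ : IsOpen Ω) {z : Heis n}
    (hz : z ∉ closure Ω) {s : ℝ} (hs : 0 ≤ s) : dil s z ∉ closure Ω := by
  intro hcon
  set A : Set ℝ := Ici 0 ∩ (fun s => dil s z) ⁻¹' closure Ω with hA
  have hAne : A.Nonempty := ⟨s, hs, hcon⟩
  have hAbd : BddBelow A := ⟨0, fun s hs => hs.1⟩
  have hAcl : IsClosed A := isClosed_Ici.inter (isClosed_closure.preimage (continuous_dil_left z))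
  have hr := hAcl.csInf_mem hAne hAbd
  set r := sInf A
  have hr0 : 0 < r := by
    refine lt_of_le_of_ne hr.1 fun h0 => hz ?_
    have : dil r z ∈ closure Ω := hr.2
    rwa [← h0, dil_zero_left] at this
  have hcl : dil r z ∈ closure Ω := hr.2
  have hlt : ∀ t ∈ Ico 0 r, dil t z ∉ closure Ω := fun t ht hmem =>
    absurd (csInf_le hAbd ⟨ht.1, hmem⟩) (not_le.2 ht.2)
  have hdd : ∀ t, dil t (dil r z) = dil (t + r) z := fun t => dil_dil t r z
  have hnear : ∀ᶠ t in 𝓝[<] (0 : ℝ), dil t (dil r z) ∉ closure Ω := by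
    filter_upwards [Ioo_mem_nhdsLT (show -r < 0 by linarith)] with t ht
    rw [hdd]
    exact hlt _ ⟨by linarith [ht.1], by linarith [ht.2]⟩
  have hin : ∀ᶠ t in 𝓝[<] (0 : ℝ), dil t (dil r z) ∈ Ω := by
    by_cases hm : dil r z ∈ Ω
    · refine nhdsWithin_le_nhds ((continuous_dil_left (dil r z)).continuousAt.eventually
        (hΩ.mem_nhds ?_))
      simpa only [dil_zero_left] using hm
    · exact (h.eventually_dil (by rw [hΩ.frontier_eq]; exact ⟨hcl, hm⟩)).2
  obtain ⟨t, h1, h2⟩ := (hnear.and hin).exists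
  exact h1 (subset_closure h2)

lemma dil_neg_mem (h : StrictStarshaped Ω ν) (hΩ : IsOpen Ω) {z : Heis n}
    (hz : z ∈ closure Ω) {s : ℝ} (hs : 0 < s) : dil (-s) z ∈ Ω := by
  by_contra hcon
  by_cases hc : dil (-s) z ∈ closure Ω
  · have hfr : dil (-s) z ∈ frontier Ω := by rw [hΩ.frontier_eq]; exact ⟨hc, hcon⟩
    obtain ⟨t, ht, ht'⟩ := ((h.eventually_dil hfr).1.and (Ioo_mem_nhdsGT hs)).exists
    refine h.dil_notMem_closure hΩ ht (s := s - t) (by linarith [ht'.2]) ?_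
    rw [dil_dil, sub_add_cancel, dil_dil_neg]
    exact hz
  · refine h.dil_notMem_closure hΩ hc hs.le ?_
    rwa [dil_dil_neg]

lemma dil_notMem (h : StrictStarshaped Ω ν) (hΩ : IsOpen Ω) {z : Heis n}
    (hz : z ∉ Ω) {s : ℝ} (hs : 0 < s) : dil s z ∉ closure Ω := fun hc => by
  have := h.dil_neg_mem hΩ hc hs
  rw [dil_neg_dil] at this
  exact hz this

lemma interior_closure (h : StrictStarshaped Ω ν) (hΩ : IsOpen Ω) :
    interior (closure Ω) = Ω := by
  refine Subset.antisymm (fun z hz => ?_) (interior_maximal subset_closure hΩ)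
  have h1 : ∀ᶠ s in 𝓝[>] (0 : ℝ), dil s z ∈ interior (closure Ω) :=
    nhdsWithin_le_nhds ((continuous_dil_left z).continuousAt.eventually
      (isOpen_interior.mem_nhds (by simpa only [dil_zero_left] using hz)))
  obtain ⟨s, hs, hs0⟩ := (h1.and self_mem_nhdsWithin).exists
  have := h.dil_neg_mem hΩ (interior_subset hs) hs0
  rwa [dil_neg_dil] at this

lemma frontier_closure (h : StrictStarshaped Ω ν) (hΩ : IsOpen Ω) :
    frontier (closure Ω) = frontier Ω := by
  rw [isClosed_closure.frontier_eq, h.interior_closure hΩ, hΩ.frontier_eq]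

protected lemma closure (h : StrictStarshaped Ω ν) (hΩ : IsOpen Ω) :
    StrictStarshaped (closure Ω) ν := by
  refine ⟨subset_closure h.1, ?_, ?_⟩
  · intro z hz
    rw [h.frontier_closure hΩ] at hz
    rw [h.frontier_closure hΩ, h.interior_closure hΩ]
    have := h.2.1 z hz
    rwa [hΩ.interior_eq] at this
  · rw [h.frontier_closure hΩ]
    exact h.2.2

end StrictStarshaped

lemma gauge4_le_of_mem_closure {a z : Heis n} {R : ℝ} (hR : 0 < R)
    (h : z ∈ closure (gaugeBall a R)) : gauge4 (mul (inv a) z) ≤ R ^ 4 := by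
  refine closure_minimal (fun w hw => ((mem_gaugeBall hR).1 hw).le) ?_ h
  exact isClosed_le (continuous_gauge4.comp (continuous_const.heis_mul continuous_id))
    continuous_const

lemma exists_gauge4_eq {K : Set (Heis n)} {z a : Heis n} {R : ℝ} (hR : 0 < R)
    (hball : gaugeBall a R ⊆ Kᶜ) (hz : z ∈ closure (gaugeBall a R)) (hzK : z ∈ K) :
    gauge4 (mul (inv a) z) = R ^ 4 ∧ ∀ w ∈ K, R ^ 4 ≤ gauge4 (mul (inv a) w) := by
  have hle : ∀ w ∈ K, R ^ 4 ≤ gauge4 (mul (inv a) w) := fun w hw => by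
    by_contra! hlt
    exact hball ((mem_gaugeBall hR).2 hlt) hw
  exact ⟨le_antisymm (gauge4_le_of_mem_closure hR hz) (hle z hzK), hle⟩

/-- `v` is the continuous extension to the whole space, by `1` on `closure Ω₁` and by `0` off `Ω₂`,
of the `p`-capacitary potential of the pair `(Ω₁, Ω₂)`. -/
structure IsPotential (p : ℝ) (Ω₁ Ω₂ : Set (Heis n)) (v : Heis n → ℝ) : Prop where
  continuous : Continuous v
  eq_one : ∀ z ∈ closure Ω₁, v z = 1
  eq_zero : ∀ z ∉ Ω₂, v z = 0
  nonneg : ∀ z, 0 ≤ v z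
  le_one : ∀ z, v z ≤ 1
  contDiffOn : ContDiffOn ℝ 1 v (Ω₂ \ closure Ω₁)
  weakSub : WeakSub p v (Ω₂ \ closure Ω₁)
  weakSub_neg : WeakSub p (fun z => -v z) (Ω₂ \ closure Ω₁)

lemma closure_diff_closure_subset {Ω₁ Ω₂ : Set (Heis n)} (h₁ : IsOpen Ω₁) :
    closure (Ω₂ \ closure Ω₁) ⊆ closure Ω₂ \ Ω₁ := by
  have : closure (closure Ω₁)ᶜ ⊆ Ω₁ᶜ := by
    rw [closure_compl]
    exact compl_subset_compl.2 (interior_maximal subset_closure h₁)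
  exact fun z hz => ⟨closure_mono sdiff_subset hz,
    this (closure_mono (fun _ hw => hw.2) hz)⟩

lemma mem_frontier_of_notMem_diff {Ω₁ Ω₂ : Set (Heis n)} (h₁ : IsOpen Ω₁) (h₂ : IsOpen Ω₂)
    {z : Heis n} (hz : z ∈ closure Ω₂ \ Ω₁) (hzD : z ∉ Ω₂ \ closure Ω₁) :
    z ∈ frontier Ω₁ ∨ z ∈ frontier Ω₂ := by
  rw [h₁.frontier_eq, h₂.frontier_eq]
  by_cases h : z ∈ Ω₂
  · exact Or.inl ⟨by by_contra hc; exact hzD ⟨h, hc⟩, hz.2⟩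
  · exact Or.inr ⟨hz.1, h⟩

lemma exists_isPotential (hn : 1 ≤ n) {p : ℝ} (hp : 1 < p) {Ω₁ Ω₂ : Set (Heis n)}
    (h₁ : IsOpen Ω₁) (h₂ : IsOpen Ω₂) (hbd : Bornology.IsBounded Ω₂) (hsub : closure Ω₁ ⊆ Ω₂)
    {u : Heis n → ℝ} (hucont : ContinuousOn u (closure Ω₂ \ Ω₁))
    (huC1 : ContDiffOn ℝ 1 u (Ω₂ \ closure Ω₁)) (huharm : PHarmonicOn p u (Ω₂ \ closure Ω₁))
    (hub1 : ∀ z ∈ frontier Ω₁, u z = 1) (hub0 : ∀ z ∈ frontier Ω₂, u z = 0) :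
    ∃ v, IsPotential p Ω₁ Ω₂ v ∧ EqOn v u (closure Ω₂ \ Ω₁) := by
  classical
  set D := Ω₂ \ closure Ω₁ with hD
  have hDo : IsOpen D := h₂.sdiff isClosed_closure
  have hDb : Bornology.IsBounded D := hbd.subset sdiff_subset
  have hDcl := closure_diff_closure_subset (Ω₂ := Ω₂) h₁
  have hDsub : D ⊆ closure Ω₂ \ Ω₁ := subset_closure.trans hDcl
  set v : Heis n → ℝ := fun z => if z ∈ Ω₁ then 1 else if z ∈ closure Ω₂ then u z else 0 with hv
  have hvu : EqOn v u (closure Ω₂ \ Ω₁) := fun z hz => by simp [hv, hz.1, hz.2]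
  have hv1 : ∀ z ∈ closure Ω₁, v z = 1 := fun z hz => by
    by_cases hzi : z ∈ Ω₁
    · simp [hv, hzi]
    · rw [hvu ⟨subset_closure (hsub hz), hzi⟩]
      exact hub1 z (by rw [h₁.frontier_eq]; exact ⟨hz, hzi⟩)
  have hv0 : ∀ z ∉ Ω₂, v z = 0 := fun z hz => by
    have hzi : z ∉ Ω₁ := fun h => hz (hsub (subset_closure h))
    by_cases hzc : z ∈ closure Ω₂
    · rw [hvu ⟨hzc, hzi⟩]
      exact hub0 z (by rw [h₂.frontier_eq]; exact ⟨hzc, hz⟩)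
    · simp [hv, hzc, hzi]
  have hvD : EqOn u v D := fun z hz => (hvu (hDsub hz)).symm
  have hvc : Continuous v := by
    have e1 : ContinuousOn v (closure Ω₁) := continuousOn_const.congr hv1
    have e2 : ContinuousOn v (closure Ω₂ \ Ω₁) := hucont.congr hvu
    have e3 : ContinuousOn v Ω₂ᶜ := continuousOn_const.congr hv0
    have hcl : IsClosed (closure Ω₂ \ Ω₁) := isClosed_closure.sdiff h₁
    have e := (e1.union_of_isClosed e2 isClosed_closure hcl).union_of_isClosed e3
      (isClosed_closure.union hcl) h₂.isClosed_compl
    refine continuousOn_univ.1 (e.mono fun z _ => ?_)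
    by_cases hz1 : z ∈ Ω₁
    · exact Or.inl (Or.inl (subset_closure hz1))
    · by_cases hz2 : z ∈ Ω₂
      · exact Or.inl (Or.inr ⟨subset_closure hz2, hz1⟩)
      · exact Or.inr hz2
  have hvC : ContDiffOn ℝ 1 v D := huC1.congr fun z hz => (hvD hz).symm
  have hvs : WeakSub p v D := huharm.weakSub.congr hDo hvD
  have hvs' : WeakSub p (fun z => -v z) D :=
    huharm.weakSub_neg.congr hDo fun z hz => by simp only [hvD hz]
  have hbdry : ∀ z, z ∉ D → v z = 0 ∨ v z = 1 := fun z hz => by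
    by_cases h : z ∈ Ω₂
    · exact Or.inr (hv1 z (by by_contra hc; exact hz ⟨h, hc⟩))
    · exact Or.inl (hv0 z h)
  have hle : ∀ z, v z ≤ 1 := fun z => by
    by_cases hz : z ∈ D
    · refine comparison hn hp hDo hDb hvs (h := fun _ => 1) (weakSub_const _ D) hvC
        contDiffOn_const hvc.continuousOn continuousOn_const (fun w _ hw => ?_) z hz
      rcases hbdry w hw with h | h <;> simp [h]
    · rcases hbdry z hz with h | h <;> simp [h]
  have hge : ∀ z, 0 ≤ v z := fun z => by
    by_cases hz : z ∈ D
    · refine comparison hn hp hDo hDb (f := fun _ => 0) (weakSub_const _ D) hvs'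
        contDiffOn_const hvC continuousOn_const hvc.continuousOn (fun w _ hw => ?_) z hz
      rcases hbdry w hw with h | h <;> simp [h]
    · rcases hbdry z hz with h | h <;> simp [h]
  exact ⟨v, ⟨hvc, hv1, hv0, hge, hle, hvC, hvs, hvs'⟩, hvu⟩

namespace IsPotential

variable {p : ℝ} {Ω₁ Ω₂ : Set (Heis n)} {ν₁ ν₂ : Heis n → Heis n} {v : Heis n → ℝ}

lemma exists_isBarrierPair_closure (h : IsPotential p Ω₁ Ω₂ v) (h₁ : IsOpen Ω₁) (h₂ : IsOpen Ω₂)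
    (hbd : Bornology.IsBounded Ω₂) (hsub : closure Ω₁ ⊆ Ω₂) (hstar : StrictStarshaped Ω₁ ν₁)
    (hext : UniformExteriorGaugeBall Ω₁) :
    ∃ M, IsBarrierPair p 1 M (closure Ω₁) (Ω₂ \ closure Ω₁) fun z => 1 - v z := by
  obtain ⟨R, hR, hball⟩ := hext
  have hfr := hstar.frontier_closure h₁
  refine ⟨R ^ 4, isClosed_closure, ?_, ?_, by have := h.continuous; fun_prop, ?_, ?_, ?_,
    h₂.sdiff isClosed_closure, hbd.subset sdiff_subset, contDiffOn_const.sub h.contDiffOn, ?_,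
    by positivity, ?_, ?_, ?_⟩
  · rw [hfr]
    exact ((hbd.subset hsub).isCompact_closure.of_isClosed_subset isClosed_frontier
      (frontier_subset_closure.trans (by rw [closure_closure])))
  · intro z hz s hs
    rw [hstar.interior_closure h₁, one_mul]
    exact hstar.dil_neg_mem h₁ hz hs
  · exact fun z => sub_nonneg.2 (h.le_one z)
  · exact fun z hz => by simp [h.eq_one z hz]
  · intro z hz1 hz2
    simp [h.eq_zero z fun hz => hz2 ⟨hz, hz1⟩]
  · convert h.weakSub.add_const (-1) using 2
    ring
  · intro z hz
    rw [hfr] at hz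
    obtain ⟨a, -, ha, ha'⟩ := hball z hz
    have hza : z ∈ closure (gaugeBall a R) := by
      have : z ∈ closure (gaugeBall a R) ∩ frontier Ω₁ := by rw [ha']; rfl
      exact this.1
    exact ⟨a, exists_gauge4_eq hR ha hza (frontier_subset_closure hz)⟩
  · obtain ⟨s, hs, hmem⟩ := exists_dil_mem hbd h₁ hstar.1
    refine ⟨s, hs, fun w hw => ?_⟩
    have hw2 : w ∈ Ω₂ := by
      by_contra hc
      simp [h.eq_zero w hc] at hw
    rw [one_mul]
    exact subset_closure (hmem w hw2)
  · intro z hz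
    rw [hfr] at hz
    obtain ⟨g, hg, hgz, hgd, hev⟩ := hstar.exists_defining hz
    refine ⟨g, hg.differentiable (by simp) z, hgz, by simpa using hgd, ?_⟩
    filter_upwards [hev] with w hw hlt
    exact subset_closure (interior_subset (hw.1.2 hlt))

lemma exists_isBarrierPair_compl (h : IsPotential p Ω₁ Ω₂ v) (h₁ : IsOpen Ω₁) (h₂ : IsOpen Ω₂)
    (hbd : Bornology.IsBounded Ω₂) (h0 : (0 : Heis n) ∈ Ω₁) (hstar : StrictStarshaped Ω₂ ν₂)
    (hint : UniformInteriorGaugeBall Ω₂) :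
    ∃ M, IsBarrierPair p (-1) M Ω₂ᶜ (Ω₂ \ closure Ω₁) v := by
  obtain ⟨R, hR, hball⟩ := hint
  refine ⟨R ^ 4, h₂.isClosed_compl, ?_, ?_, h.continuous, h.nonneg, h.eq_zero, ?_,
    h₂.sdiff isClosed_closure, hbd.subset sdiff_subset, h.contDiffOn, h.weakSub_neg,
    by positivity, ?_, ?_, ?_⟩
  · rw [frontier_compl]
    exact hbd.isCompact_closure.of_isClosed_subset isClosed_frontier frontier_subset_closure
  · intro z hz s hs
    rw [interior_compl, neg_one_mul, neg_neg]
    exact hstar.dil_notMem h₂ hz hs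
  · intro z hz1 hz2
    refine (h.eq_one z ?_).ge
    by_contra hc
    exact hz2 ⟨notMem_compl_iff.1 hz1, hc⟩
  · intro z hz
    rw [frontier_compl] at hz
    obtain ⟨a, -, ha, ha'⟩ := hball z hz
    have hza : z ∈ closure (gaugeBall a R) := by
      have : z ∈ closure (gaugeBall a R) ∩ frontier Ω₂ := by rw [ha']; rfl
      exact this.1
    rw [h₂.frontier_eq] at hz
    exact ⟨a, exists_gauge4_eq hR (by rwa [compl_compl]) hza hz.2⟩
  · obtain ⟨s, hs, hmem⟩ := exists_dil_mem hbd h₁ h0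
    refine ⟨s, hs, fun w hw hc => ?_⟩
    rw [neg_one_mul, neg_neg] at hc
    have := hmem _ hc
    rw [dil_neg_dil] at this
    simp [h.eq_one w (subset_closure this)] at hw
  · intro z hz
    rw [frontier_compl] at hz
    obtain ⟨g, hg, hgz, hgd, hev⟩ := hstar.exists_defining hz
    refine ⟨fun w => -g w, (hg.differentiable (by simp) z).neg, by simp [hgz], ?_, ?_⟩
    · rw [fderiv_fun_neg]
      simpa using hgd
    · filter_upwards [hev] with w hw hlt hc
      have := hw.1.1 (by rwa [h₂.interior_eq])
      linarith

lemma fderiv_Zvf_neg (h : IsPotential p Ω₁ Ω₂ v) (hn : 1 ≤ n) (hp : 1 < p)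
    (h₁ : IsOpen Ω₁) (h₂ : IsOpen Ω₂) (hbd : Bornology.IsBounded Ω₂) (hsub : closure Ω₁ ⊆ Ω₂)
    (hstar₁ : StrictStarshaped Ω₁ ν₁) (hstar₂ : StrictStarshaped Ω₂ ν₂)
    (hext : UniformExteriorGaugeBall Ω₁) (hint : UniformInteriorGaugeBall Ω₂)
    {z : Heis n} (hz : z ∈ Ω₂ \ closure Ω₁) : fderiv ℝ v z (Zvf z) < 0 := by
  obtain ⟨M₁, hB₁⟩ := h.exists_isBarrierPair_closure h₁ h₂ hbd hsub hstar₁ hext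
  obtain ⟨M₂, hB₂⟩ := h.exists_isBarrierPair_compl h₁ h₂ hbd hstar₁.1 hstar₂ hint
  obtain ⟨c₁, hc₁, s₁, hs₁, hg₁⟩ := hB₁.exists_linear_growth hn hp
  obtain ⟨c₂, hc₂, s₂, hs₂, hg₂⟩ := hB₂.exists_linear_growth hn hp
  rw [hstar₁.frontier_closure h₁] at hg₁
  rw [frontier_compl] at hg₂
  set D := Ω₂ \ closure Ω₁ with hD
  have hDo : IsOpen D := h₂.sdiff isClosed_closure
  have hDcl := closure_diff_closure_subset (Ω₂ := Ω₂) h₁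
  set c := min c₁ c₂ with hc
  have hc0 : 0 < c := lt_min hc₁ hc₂
  have hdecay : ∀ s : ℝ, 0 < s → s ≤ s₁ → s ≤ s₂ → ∀ w ∈ D, dil s w ∈ D →
      v (dil s w) + c * s ≤ v w := by
    intro s hs hs1 hs2 w hw hw'
    have hcont : Continuous (dil s : Heis n → Heis n) := by fun_prop
    have hcd : ContDiff ℝ 1 (dil s : Heis n → Heis n) := by
      rw [← show ((dilMap s).toHomeo : Heis n → Heis n) = dil s from funext (dilMap_apply s)]
      exact (dilMap s).contDiff_toHomeo
    set U := D ∩ dil s ⁻¹' D with hU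
    have hws : WeakSub p (fun z => v (dil s z)) (dil s ⁻¹' D) := by
      have := (dilMap s).weakSub_comp h.weakSub hDo h.contDiffOn
      have he : ((dilMap s).toHomeo : Heis n → Heis n) = dil s := funext (dilMap_apply s)
      rwa [he] at this
    refine comparison hn hp (U := U) (f := fun z => v (dil s z) + c * s)
      (hDo.inter (hDo.preimage hcont)) (hbd.subset fun z hz => hz.1.1)
      ((hws.mono inter_subset_right).add_const _) (h.weakSub_neg.mono inter_subset_left)
      ((h.contDiffOn.comp hcd.contDiffOn fun z hz => hz.2).add contDiffOn_const)
      (h.contDiffOn.mono inter_subset_left)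
      ((h.continuous.comp hcont).add continuous_const).continuousOn h.continuous.continuousOn
      (fun z hz hzU => ?_) w ⟨hw, hw'⟩
    have hz1 := hDcl (closure_mono inter_subset_left hz)
    have hz2 : dil s z ∈ closure Ω₂ \ Ω₁ := hDcl (by
      have := hcont.closure_preimage_subset D (closure_mono inter_subset_right hz)
      exact this)
    have hcc₁ : c * s ≤ c₁ * s := by gcongr; exact min_le_left _ _
    have hcc₂ : c * s ≤ c₂ * s := by gcongr; exact min_le_right _ _
    by_cases hzD : z ∈ D
    · have hzD' : dil s z ∉ D := fun h => hzU ⟨hzD, h⟩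
      rcases mem_frontier_of_notMem_diff h₁ h₂ hz2 hzD' with hf | hf
      · have := hstar₁.dil_neg_mem h₁ (frontier_subset_closure hf) hs
        rw [dil_neg_dil] at this
        exact absurd this hz1.2
      · have := hg₂ _ hf s ⟨hs.le, hs2⟩
        rw [neg_one_mul, dil_neg_dil] at this
        rw [h₂.frontier_eq] at hf
        simp only [h.eq_zero _ hf.2]
        linarith
    · rcases mem_frontier_of_notMem_diff h₁ h₂ hz1 hzD with hf | hf
      · have := hg₁ _ hf s ⟨hs.le, hs1⟩
        rw [one_mul] at this
        simp only [h.eq_one _ (frontier_subset_closure hf)]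
        linarith
      · rw [h₂.frontier_eq] at hf
        exact absurd hz2.1 (hstar₂.dil_notMem h₂ hf.2 hs)
  have hdiff : DifferentiableAt ℝ v z :=
    (h.contDiffOn.contDiffAt (hDo.mem_nhds hz)).differentiableAt (by simp)
  have hlim := (hasDerivAt_comp_dil hdiff).tendsto_slope_zero_right
  have hev : ∀ᶠ s in 𝓝[>] (0 : ℝ), dil s z ∈ D :=
    nhdsWithin_le_nhds ((continuous_dil_left z).continuousAt.eventually
      (hDo.mem_nhds (by simpa only [dil_zero_left] using hz)))
  refine (le_of_tendsto hlim (b := -c) ?_).trans_lt (by linarith)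
  filter_upwards [hev, Ioo_mem_nhdsGT (lt_min hs₁ hs₂)] with s hsD hs
  have := hdecay s hs.1 (hs.2.le.trans (min_le_left _ _)) (hs.2.le.trans (min_le_right _ _)) z hz
    hsD
  simp only [zero_add, dil_zero_left, smul_eq_mul]
  rw [inv_mul_le_iff₀ hs.1]
  linarith

lemma lt_one (h : IsPotential p Ω₁ Ω₂ v) (hn : 1 ≤ n) (hp : 1 < p)
    (h₁ : IsOpen Ω₁) (h₂ : IsOpen Ω₂) (hbd : Bornology.IsBounded Ω₂) (hsub : closure Ω₁ ⊆ Ω₂)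
    (hstar₁ : StrictStarshaped Ω₁ ν₁) (hext : UniformExteriorGaugeBall Ω₁)
    {z : Heis n} (hz : z ∉ closure Ω₁) : v z < 1 := by
  obtain ⟨M₁, hB₁⟩ := h.exists_isBarrierPair_closure h₁ h₂ hbd hsub hstar₁ hext
  linarith [hB₁.pos_of_notMem hn hp hz]

end IsPotential

lemma exists_contDiff_eventuallyEq {f : Heis n → ℝ} {D : Set (Heis n)} (hD : IsOpen D)
    (hf : ContDiffOn ℝ 1 f D) {z : Heis n} (hz : z ∈ D) :
    ∃ g : Heis n → ℝ, ContDiff ℝ 1 g ∧ g =ᶠ[𝓝 z] f := by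
  obtain ⟨r, hr, hball⟩ := Metric.nhds_basis_closedBall.mem_iff.1 (hD.mem_nhds hz)
  let χ : ContDiffBump z := ⟨r / 2, r, by positivity, by linarith⟩
  refine ⟨fun w => χ w * f w, contDiff_iff_contDiffAt.2 fun w => ?_, ?_⟩
  · by_cases hw : w ∈ D
    · exact χ.contDiffAt.mul (hf.contDiffAt (hD.mem_nhds hw))
    · have hw' : w ∉ tsupport χ := fun h => hw (hball (by rwa [χ.tsupport_eq] at h))
      refine (contDiffAt_const (c := (0 : ℝ))).congr_of_eventuallyEq ?_
      filter_upwards [notMem_tsupport_iff_eventuallyEq.1 hw'] with y hy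
      simp [hy]
  · filter_upwards [χ.eventuallyEq_one] with w hw
    simp [hw]

/-- A superlevel set of a function decreasing along the dilations is strictly starshaped. -/
lemma strictStarshaped_superlevel {v : Heis n → ℝ} {D : Set (Heis n)} {t : ℝ}
    (hv : Continuous v) (hD : IsOpen D) (hvD : ContDiffOn ℝ 1 v D) (h0 : t ≤ v 0)
    (hmem : ∀ z, v z = t → z ∈ D) (hneg : ∀ z ∈ D, fderiv ℝ v z (Zvf z) < 0) :
    ∃ ν : Heis n → Heis n, StrictStarshaped {z | t ≤ v z} ν := by
  have hint : interior {z | t ≤ v z} = {z | t < v z} := by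
    refine Subset.antisymm (fun z hz => ?_)
      (interior_maximal (fun z (hz : t < v z) => hz.le) (isOpen_lt continuous_const hv))
    have hle : t ≤ v z := interior_subset (s := {z | t ≤ v z}) hz
    refine lt_of_le_of_ne hle fun hzt => ?_
    have hzD := hmem z hzt.symm
    have hdiff : DifferentiableAt ℝ v z :=
      (hvD.contDiffAt (hD.mem_nhds hzD)).differentiableAt (by simp)
    have hev : ∀ᶠ s in 𝓝[>] (0 : ℝ), dil s z ∈ interior {z | t ≤ v z} :=
      nhdsWithin_le_nhds ((continuous_dil_left z).continuousAt.eventually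
        (isOpen_interior.mem_nhds (by simpa only [dil_zero_left] using hz)))
    refine absurd (ge_of_tendsto (hasDerivAt_comp_dil hdiff).tendsto_slope_zero_right (b := 0) ?_)
      (not_le.2 (hneg z hzD))
    filter_upwards [hev, self_mem_nhdsWithin] with s hs hs0
    have h1 : t ≤ v (dil s z) := interior_subset (s := {z | t ≤ v z}) hs
    have h2 : (0 : ℝ) < s := hs0
    simp only [zero_add, dil_zero_left, smul_eq_mul, ← hzt]
    exact mul_nonneg (by positivity) (sub_nonneg.2 h1)
  have hfr : frontier {z | t ≤ v z} = {z | v z = t} := by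
    rw [(isClosed_le continuous_const hv).frontier_eq, hint]
    ext z
    simp only [Set.mem_sdiff, mem_ofPred_eq, not_lt]
    exact ⟨fun h => le_antisymm h.2 h.1, fun h => ⟨h.ge, h.le⟩⟩
  have hfd : ∀ z, fderiv ℝ (fun w => t - v w) z (Zvf z) = -fderiv ℝ v z (Zvf z) := fun z => by
    rw [fderiv_const_sub]; rfl
  have hne : ∀ z ∈ D, grad (fun w => t - v w) z ≠ 0 := fun z hz =>
    grad_ne_zero (v := Zvf z) (by rw [hfd]; linarith [hneg z hz])
  have hnorm : ∀ w : Heis n, w ≠ 0 → 0 < euclNorm w := fun w hw => by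
    obtain ⟨k, hk⟩ := Function.ne_iff.1 hw
    exact Real.sqrt_pos.2 (Finset.sum_pos' (fun i _ => sq_nonneg _)
      ⟨k, Finset.mem_univ k, sq_pos_of_ne_zero hk⟩)
  refine ⟨fun z => (euclNorm (grad (fun w => t - v w) z))⁻¹ • grad (fun w => t - v w) z, h0,
    fun z hz => ?_, fun z hz => ?_⟩
  · rw [hfr] at hz
    have hzD := hmem z hz
    obtain ⟨g, hg, hgv⟩ := exists_contDiff_eventuallyEq hD (contDiffOn_const (c := t).sub hvD) hzD
    obtain ⟨V, hV, hVo, hzV⟩ := eventually_nhds_iff.1 (hgv.and (hD.mem_nhds hzD))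
    have hgrad : ∀ w ∈ V, grad g w = grad (fun w => t - v w) w := fun w hw => by
      have : g =ᶠ[𝓝 w] fun w => t - v w :=
        eventuallyEq_of_mem (hVo.mem_nhds hw) fun y hy => (hV y hy).1
      ext k
      simp only [grad, this.fderiv_eq]
    refine ⟨V, g, hVo, hzV, hg, fun w hw => ?_, fun w hw => ?_, fun w hw _ => ?_⟩
    · rw [hint, (hV w hw).1]
      simp
    · rw [hfr, (hV w hw).1, mem_ofPred_eq, sub_eq_zero, eq_comm]
    · rw [hgrad w hw]
      exact ⟨hne w (hV w hw).2, rfl⟩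
  · rw [hfr] at hz
    have hzD := hmem z hz
    have : einner ((euclNorm (grad (fun w => t - v w) z))⁻¹ • grad (fun w => t - v w) z) (Zvf z) =
        (euclNorm (grad (fun w => t - v w) z))⁻¹ * einner (grad (fun w => t - v w) z) (Zvf z) := by
      simp [einner, Finset.mul_sum, mul_assoc]
    rw [this, einner_grad, hfd]
    exact mul_pos (inv_pos.2 (hnorm _ (hne z hzD))) (neg_pos.2 (hneg z hzD))

end Heis

/-- Level sets of the `p`-capacitary potential of a strictly
starshaped annulus in the Heisenberg group are bounded, `C¹`, strictly
starshaped, and the Euclidean gradient of the potential never vanishes. -/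
theorem levelSets_strictStarshaped
    (n : ℕ) (hn : 1 ≤ n) (p : ℝ) (hp : 1 < p) (hpQ : p ≠ 2 * (n : ℝ) + 2)
    (Ω₁ Ω₂ : Set (Heis n)) (ν₁ ν₂ : Heis n → Heis n)
    (hΩ₁open : IsOpen Ω₁) (hΩ₂open : IsOpen Ω₂)
    (hΩ₁bd : Bornology.IsBounded Ω₁) (hΩ₂bd : Bornology.IsBounded Ω₂)
    (hsub : closure Ω₁ ⊆ Ω₂)
    (hstar₁ : Heis.StrictStarshaped Ω₁ ν₁) (hstar₂ : Heis.StrictStarshaped Ω₂ ν₂)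
    (hext : Heis.UniformExteriorGaugeBall Ω₁)
    (hint : Heis.UniformInteriorGaugeBall Ω₂)
    (u : Heis n → ℝ)
    (hucont : ContinuousOn u (closure Ω₂ \ Ω₁))
    (huC1 : ContDiffOn ℝ 1 u (Ω₂ \ closure Ω₁))
    (huharm : Heis.PHarmonicOn p u (Ω₂ \ closure Ω₁))
    (hub1 : ∀ z ∈ frontier Ω₁, u z = 1)
    (hub0 : ∀ z ∈ frontier Ω₂, u z = 0) :
    (∀ t ∈ Set.Icc (0 : ℝ) 1,
      Bornology.IsBounded ({z ∈ closure Ω₂ \ Ω₁ | t ≤ u z} ∪ closure Ω₁) ∧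
      ∃ ν : Heis n → Heis n,
        Heis.StrictStarshaped ({z ∈ closure Ω₂ \ Ω₁ | t ≤ u z} ∪ closure Ω₁) ν) ∧
    ∀ w ∈ Ω₂ \ closure Ω₁, Heis.grad u w ≠ 0 := by
  obtain ⟨v, hv, hvu⟩ := Heis.exists_isPotential hn hp hΩ₁open hΩ₂open hΩ₂bd hsub hucont huC1
    huharm hub1 hub0
  have hDo : IsOpen (Ω₂ \ closure Ω₁) := hΩ₂open.sdiff isClosed_closure
  have hDu : EqOn v u (Ω₂ \ closure Ω₁) := fun z hz =>
    hvu ⟨subset_closure hz.1, fun h => hz.2 (subset_closure h)⟩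
  have hneg : ∀ z ∈ Ω₂ \ closure Ω₁, fderiv ℝ v z (Heis.Zvf z) < 0 := fun z hz =>
    hv.fderiv_Zvf_neg hn hp hΩ₁open hΩ₂open hΩ₂bd hsub hstar₁ hstar₂ hext hint hz
  refine ⟨fun t ht => ⟨hΩ₂bd.closure.subset ?_, ?_⟩, fun w hw => ?_⟩
  · exact union_subset (fun z hz => hz.1.1) (hsub.trans subset_closure)
  · rcases ht.1.eq_or_lt with rfl | ht0
    · refine ⟨ν₂, ?_⟩
      convert hstar₂.closure hΩ₂open using 1
      refine Subset.antisymm (union_subset (fun z hz => hz.1.1) (hsub.trans subset_closure))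
        fun z hz => ?_
      by_cases hz1 : z ∈ closure Ω₁
      · exact Or.inr hz1
      · have hz2 : z ∈ closure Ω₂ \ Ω₁ := ⟨hz, fun h => hz1 (subset_closure h)⟩
        exact Or.inl ⟨hz2, by rw [← hvu hz2]; exact hv.nonneg z⟩
    have hset : {z ∈ closure Ω₂ \ Ω₁ | t ≤ u z} ∪ closure Ω₁ = {z | t ≤ v z} := by
      refine Subset.antisymm (union_subset (fun z hz => ?_) fun z hz => ?_) fun z hz => ?_
      · exact hz.2.trans_eq (hvu hz.1).symm
      · exact ht.2.trans_eq (hv.eq_one z hz).symm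
      · by_cases hz1 : z ∈ closure Ω₁
        · exact Or.inr hz1
        · have hz2 : z ∈ closure Ω₂ := by
            by_contra hc
            have hz' : t ≤ v z := hz
            rw [hv.eq_zero z fun h => hc (subset_closure h)] at hz'
            linarith
          have hz3 : z ∈ closure Ω₂ \ Ω₁ := ⟨hz2, fun h => hz1 (subset_closure h)⟩
          exact Or.inl ⟨hz3, hz.trans_eq (hvu hz3)⟩
    rw [hset]
    have hlt : ∀ z, z ∉ closure Ω₁ → v z < 1 := fun z hz =>
      hv.lt_one hn hp hΩ₁open hΩ₂open hΩ₂bd hsub hstar₁ hext hz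
    rcases ht.2.eq_or_lt with rfl | ht1
    · refine ⟨ν₁, ?_⟩
      convert hstar₁.closure hΩ₁open using 1
      ext z
      refine ⟨fun hz => ?_, fun hz => (hv.eq_one z hz).ge⟩
      by_contra hc
      exact (hlt z hc).not_ge hz
    · refine Heis.strictStarshaped_superlevel hv.continuous hDo hv.contDiffOn ?_
        (fun z hz => ⟨?_, fun hc => ?_⟩) hneg
      · rw [hv.eq_one 0 (subset_closure hstar₁.1)]
        exact ht.2
      · by_contra hc
        rw [hv.eq_zero z hc] at hz
        exact ht0.ne hz
      · rw [hv.eq_one z hc] at hz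
        exact ht1.ne' hz
  · refine Heis.grad_ne_zero (v := Heis.Zvf w) ?_
    have : u =ᶠ[nhds w] v := Filter.eventuallyEq_of_mem (hDo.mem_nhds hw) fun z hz => (hDu hz).symm
    rw [this.fderiv_eq]
    exact (hneg w hw).ne
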